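/- Let K = ℚ(√5) ⊂ ℝ, let A be the ring of integers of K, and let q be the quadratic form in 5 variables x_0,...,x_4 over K whose Gram matrix Q is the symmetric matrix with all diagonal entries equal to 1, with entries Q_{01} = Q_{10} = Q_{34} = Q_{43} = −(1+√5)/4, with entries Q_{12} = Q_{21} = Q_{23} = Q_{32} = −1/2, and with all other entries 0. Then the group O(q,A) of matrices M ∈ GL(5,A) satisfying Mᵀ Q M = Q is noncoherent: it contains a finitely generated subgroup thatated is not finitely presented. -/

import Mathlib

namespace Paper

open Matrix

/-- Value at `x` of the quadratic form with Gram matrix `Q`. -/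
def qeval {m : ℕ} {R : Type*} [CommRing R] (Q : Matrix (Fin m) (Fin m) R) (x : Fin m → R) : R :=
  x ⬝ᵥ (Q *ᵥ x)

/-- The polar bilinear form `B(x,y) = (f(x+y) - f(x) - f(y))/2` of the quadratic form
with Gram matrix `Q`. -/
def qpolar {m : ℕ} {K : Type*} [Field K] (Q : Matrix (Fin m) (Fin m) K) (x y : Fin m → K) : K :=
  (qeval Q (x + y) - qeval Q x - qeval Q y) / 2

/-- A real quadratic form (given by its Gram matrix `Q`) has signature `(r,s)`:
`r + s = m` and it is linearly equivalent over `ℝ` to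
`x_1^2 + ... + x_r^2 - x_{r+1}^2 - ... - x_m^2`. -/
def RealSignature {m : ℕ} (Q : Matrix (Fin m) (Fin m) ℝ) (r s : ℕ) : Prop :=
  r + s = m ∧ ∃ T : Matrix (Fin m) (Fin m) ℝ, T.det ≠ 0 ∧
    ∀ x : Fin m → ℝ, qeval Q (T *ᵥ x) = ∑ i : Fin m, (if (i : ℕ) < r then (x i)^2 else -(x i)^2)

/-- A rational quadratic form has signature `(r,s)` if it does as a real quadratic form. -/
def HasSignature {m : ℕ} (Q : Matrix (Fin m) (Fin m) ℚ) (r s : ℕ) : Prop :=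
  RealSignature (Q.map (Rat.cast : ℚ → ℝ)) r s

/-- The rational quadratic form `F` (in `n` variables) represents the rational quadratic
form `G` (in `k` variables): after a linear change of coordinates over `ℚ`,
`F(x_1,...,x_n) = G(x_1,...,x_k) + H(x_{k+1},...,x_n)` for some rational quadratic form `H`. -/
def Represents {n k : ℕ} (F : Matrix (Fin n) (Fin n) ℚ) (G : Matrix (Fin k) (Fin k) ℚ) : Prop :=
  ∃ (m : ℕ) (hm : n = k + m) (H : Matrix (Fin m) (Fin m) ℚ) (T : Matrix (Fin n) (Fin n) ℚ),
    T.det ≠ 0 ∧ ∀ (x : Fin k → ℚ) (y : Fin m → ℚ),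
      qeval F (T *ᵥ (Fin.append x y ∘ Fin.cast hm)) = qeval G x + qeval H y

/-- The group `O(f, A)` of matrices in `GL(m, A)` preserving the quadratic form `f`
(with Gram matrix `Q` over `K ⊇ A`): those `M` with `f(Mx) = f(x)` for all `x`. -/
def ortho {m : ℕ} (A : Type*) [CommRing A] {K : Type*} [Field K] [Algebra A K]
    (Q : Matrix (Fin m) (Fin m) K) : Subgroup (GL (Fin m) A) where
  carrier := { M | ∀ x : Fin m → K,
      qeval Q (((M : Matrix (Fin m) (Fin m) A).map (algebraMap A K)) *ᵥ x) = qeval Q x }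
  one_mem' := by
    intro x
    have h1 : ((1 : GL (Fin m) A) : Matrix (Fin m) (Fin m) A).map (algebraMap A K) = 1 := by
      simp [Matrix.map_one]
    rw [h1, Matrix.one_mulVec]
  mul_mem' := by
    intro a b ha hb x
    have h : ((a * b : GL (Fin m) A) : Matrix (Fin m) (Fin m) A).map (algebraMap A K)
        = ((a : Matrix (Fin m) (Fin m) A).map (algebraMap A K)) *
          ((b : Matrix (Fin m) (Fin m) A).map (algebraMap A K)) := by
      rw [Units.val_mul, Matrix.map_mul]
    rw [h, ← Matrix.mulVec_mulVec, ha, hb]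
  inv_mem' := by
    intro a ha x
    set M := ((a : Matrix (Fin m) (Fin m) A).map (algebraMap A K)) with hM
    set N := (((a⁻¹ : GL (Fin m) A) : Matrix (Fin m) (Fin m) A).map (algebraMap A K)) with hN
    have hMN : M * N = 1 := by
      rw [hM, hN, ← Matrix.map_mul]
      have : (a : Matrix (Fin m) (Fin m) A) * ((a⁻¹ : GL (Fin m) A) : Matrix (Fin m) (Fin m) A)
          = 1 := a.mul_inv
      rw [this]
      simp [Matrix.map_one]
    have ha' : ∀ y : Fin m → K, qeval Q (M *ᵥ y) = qeval Q y := ha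
    calc qeval Q (N *ᵥ x) = qeval Q (M *ᵥ (N *ᵥ x)) := (ha' (N *ᵥ x)).symm
      _ = qeval Q ((M * N) *ᵥ x) := by rw [Matrix.mulVec_mulVec]
      _ = qeval Q x := by rw [hMN, Matrix.one_mulVec]

/-- `O(f, ℤ)` for a rational quadratic form `f` with Gram matrix `Q`. -/
abbrev OZ {m : ℕ} (Q : Matrix (Fin m) (Fin m) ℚ) : Subgroup (GL (Fin m) ℤ) := ortho ℤ Q

/-- A group is finitely presented: it is a quotient of a finitely generated free group by
the normal closure of a finite set of relators. -/
def IsFinitelyPresented (G : Type*) [Group G] : Prop :=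
  ∃ (n : ℕ) (rels : Set (FreeGroup (Fin n))), rels.Finite ∧ Nonempty (PresentedGroup rels ≃* G)

/-- A group is coherent if each of its finitely generated subgroups is finitely presented. -/
def IsCoherent (G : Type*) [Group G] : Prop :=
  ∀ H : Subgroup G, Group.FG H → IsFinitelyPresented H

/-- Two groups are abstractly commensurable if they contain isomorphic
subgroups of finite index. -/
def AbstractlyCommensurable (G H : Type*) [Group G] [Group H] : Prop :=
  ∃ (G' : Subgroup G) (H' : Subgroup H), G'.FiniteIndex ∧ H'.FiniteIndex ∧ Nonempty (G' ≃* H')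

/-- The form `q₃ = -x₀² + x₁² + x₂² + x₃²`. -/
def q3 : Matrix (Fin 4) (Fin 4) ℚ := Matrix.diagonal ![-1, 1, 1, 1]


open Matrix

/-- The group `O(f, A)` of matrices `M ∈ GL(m, A)` satisfying `Mᵀ Q M = Q`, where `Q`
is the (symmetric) Gram matrix over `K ⊇ A` of the quadratic form `f`. -/
def orthoGram {m : ℕ} (A : Type*) [CommRing A] {K : Type*} [Field K] [Algebra A K]
    (Q : Matrix (Fin m) (Fin m) K) : Subgroup (GL (Fin m) A) where
  carrier := { M | (((M : Matrix (Fin m) (Fin m) A).map (algebraMap A K))ᵀ) * Q *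
      ((M : Matrix (Fin m) (Fin m) A).map (algebraMap A K)) = Q }
  one_mem' := by
    show (((1 : GL (Fin m) A) : Matrix (Fin m) (Fin m) A).map (algebraMap A K))ᵀ * Q *
      (((1 : GL (Fin m) A) : Matrix (Fin m) (Fin m) A).map (algebraMap A K)) = Q
    have h1 : ((1 : GL (Fin m) A) : Matrix (Fin m) (Fin m) A).map (algebraMap A K) = 1 := by
      simp [Matrix.map_one]
    rw [h1]
    simp
  mul_mem' := by
    intro a b ha hb
    show _ = Q
    have h : ((a * b : GL (Fin m) A) : Matrix (Fin m) (Fin m) A).map (algebraMap A K)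
        = ((a : Matrix (Fin m) (Fin m) A).map (algebraMap A K)) *
          ((b : Matrix (Fin m) (Fin m) A).map (algebraMap A K)) := by
      rw [Units.val_mul, Matrix.map_mul]
    set X := ((a : Matrix (Fin m) (Fin m) A).map (algebraMap A K))
    set Y := ((b : Matrix (Fin m) (Fin m) A).map (algebraMap A K))
    have ha' : Xᵀ * Q * X = Q := ha
    have hb' : Yᵀ * Q * Y = Q := hb
    rw [h, Matrix.transpose_mul]
    calc Yᵀ * Xᵀ * Q * (X * Y) = Yᵀ * (Xᵀ * Q * X) * Y := by
          simp only [Matrix.mul_assoc]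
      _ = Q := by rw [ha', hb']
  inv_mem' := by
    intro a ha
    set M := ((a : Matrix (Fin m) (Fin m) A).map (algebraMap A K)) with hMdef
    set N := (((a⁻¹ : GL (Fin m) A) : Matrix (Fin m) (Fin m) A).map (algebraMap A K)) with hNdef
    have hMN : M * N = 1 := by
      rw [hMdef, hNdef, ← Matrix.map_mul]
      have : (a : Matrix (Fin m) (Fin m) A) * ((a⁻¹ : GL (Fin m) A) : Matrix (Fin m) (Fin m) A)
          = 1 := a.mul_inv
      rw [this]
      simp [Matrix.map_one]
    have ha' : Mᵀ * Q * M = Q := ha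
    show Nᵀ * Q * N = Q
    calc Nᵀ * Q * N = Nᵀ * (Mᵀ * Q * M) * N := by rw [ha']
      _ = (M * N)ᵀ * Q * (M * N) := by
          rw [Matrix.transpose_mul]
          simp only [Matrix.mul_assoc]
      _ = Q := by rw [hMN]; simp

noncomputable section

/-- The field `K = ℚ(√5) ⊆ ℝ`. -/
abbrev Ksqrt5 : IntermediateField ℚ ℝ := IntermediateField.adjoin ℚ {Real.sqrt 5}

/-- `√5` as an element of `ℚ(√5)`. -/
def sqrt5 : Ksqrt5 :=
  ⟨Real.sqrt 5, IntermediateField.subset_adjoin ℚ {Real.sqrt 5} rfl⟩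

/-- The ring of integers `A` of `ℚ(√5)`. -/
abbrev Asqrt5 := NumberField.RingOfIntegers Ksqrt5

/-- The Gram matrix of the quadratic form of the right-angled regular 120-cell:
diagonal entries `1`, entries `Q₀₁ = Q₁₀ = Q₃₄ = Q₄₃ = -(1+√5)/4 = -cos(π/5)`,
entries `Q₁₂ = Q₂₁ = Q₂₃ = Q₃₂ = -1/2`, all other entries `0`. -/
def Q120 : Matrix (Fin 5) (Fin 5) Ksqrt5 :=
  !![1, -(1 + sqrt5)/4, 0, 0, 0;
     -(1 + sqrt5)/4, 1, -(1/2), 0, 0;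
     0, -(1/2), 1, -(1/2), 0;
     0, 0, -(1/2), 1, -(1 + sqrt5)/4;
     0, 0, 0, -(1 + sqrt5)/4, 1]

end


-- PARTS
section
theorem ker_fng {K H : Type*} [Group K] [Group H] [hK : Group.FG K] (hH : IsFinitelyPresented H)
    (π : K →* H) (hπ : Function.Surjective π) :
    ∃ T : Set K, T.Finite ∧ π.ker = Subgroup.normalClosure T := by
  obtain ⟨n, rels, hrels, ⟨e⟩⟩ := hH
  obtain ⟨X, hX, hXf⟩ := Group.fg_iff.1 hK
  let φ : FreeGroup (Fin n) →* H := e.toMonoidHom.comp (PresentedGroup.mk rels)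
  have hφ : Function.Surjective φ := e.surjective.comp (PresentedGroup.mk_surjective rels)
  choose k hk using fun i => hπ (φ (FreeGroup.of i))
  let s : FreeGroup (Fin n) →* K := FreeGroup.lift k
  have hs : π.comp s = φ := by
    ext i; simp [s, hk]
  choose w hw using fun x => hφ (π x)
  let T : Set K := s '' rels ∪ (fun x => x⁻¹ * s (w x)) '' X
  refine ⟨T, (hrels.image _).union (hXf.image _), ?_⟩
  have hs' : ∀ y, π (s y) = φ y := fun y => DFunLike.congr_fun hs y
  apply le_antisymm
  · let q := QuotientGroup.mk' (Subgroup.normalClosure T)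
    have hq : ∀ t ∈ T, q t = 1 := fun t ht =>
      (QuotientGroup.eq_one_iff t).2 (Subgroup.subset_normalClosure ht)
    have h1 : ∀ r ∈ rels, FreeGroup.lift (fun i => q (k i)) r = 1 := by
      intro r hr
      have : FreeGroup.lift (fun i => q (k i)) = q.comp s := by ext i; simp [s]
      rw [this]
      exact hq _ (Or.inl ⟨r, hr, rfl⟩)
    let ψ0 : PresentedGroup rels →* _ := PresentedGroup.toGroup h1
    let ψ : H →* _ := ψ0.comp e.symm.toMonoidHom
    have hψ : ψ.comp φ = q.comp s := by
      ext i
      simp [ψ, φ, s, ψ0]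
      exact PresentedGroup.toGroup.of h1
    have hψ' : ∀ y, ψ (φ y) = q (s y) := fun y => DFunLike.congr_fun hψ y
    have h2 : ψ.comp π = q := by
      apply MonoidHom.eq_of_eqOn_dense hX
      intro x hx
      have h3 : q (x⁻¹ * s (w x)) = 1 := hq _ (Or.inr ⟨x, hx, rfl⟩)
      rw [map_mul, map_inv, inv_mul_eq_one] at h3
      rw [MonoidHom.comp_apply, ← hw x, hψ', h3]
    intro y hy
    have : q y = 1 := by
      rw [← h2, MonoidHom.comp_apply, MonoidHom.mem_ker.1 hy, map_one]
    exact (QuotientGroup.eq_one_iff y).1 this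
  · apply Subgroup.normalClosure_le_normal
    rintro t (⟨r, hr, rfl⟩ | ⟨x, hx, rfl⟩)
    · show π (s r) = 1
      rw [hs']
      show e (PresentedGroup.mk rels r) = 1
      have : PresentedGroup.mk rels r = 1 := PresentedGroup.one_of_mem hr
      rw [this, map_one]
    · show π (x⁻¹ * s (w x)) = 1
      rw [map_mul, hs', hw, map_inv, inv_mul_cancel]

theorem normalClosure_finite {K : Type*} [Group K] (S : Set K) (x : K)
    (hx : x ∈ Subgroup.normalClosure S) :
    ∃ F : Set K, F.Finite ∧ F ⊆ S ∧ x ∈ Subgroup.normalClosure F := by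
  let L : Subgroup K :=
    { carrier := {x | ∃ F : Set K, F.Finite ∧ F ⊆ S ∧ x ∈ Subgroup.normalClosure F}
      one_mem' := ⟨∅, Set.finite_empty, Set.empty_subset _, one_mem _⟩
      mul_mem' := by
        rintro a b ⟨F, hF, hFS, ha⟩ ⟨F', hF', hFS', hb⟩
        exact ⟨F ∪ F', hF.union hF', Set.union_subset hFS hFS',
          mul_mem (Subgroup.normalClosure_mono Set.subset_union_left ha)
            (Subgroup.normalClosure_mono Set.subset_union_right hb)⟩
      inv_mem' := by
        rintro a ⟨F, hF, hFS, ha⟩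
        exact ⟨F, hF, hFS, inv_mem ha⟩ }
  have hL : L.Normal := ⟨by
    rintro a ⟨F, hF, hFS, ha⟩ g
    exact ⟨F, hF, hFS, Subgroup.normalClosure_normal.conj_mem a ha g⟩⟩
  have : Subgroup.normalClosure S ≤ L := Subgroup.normalClosure_le_normal fun s hs =>
    ⟨{s}, Set.finite_singleton s, by simpa using hs, Subgroup.subset_normalClosure rfl⟩
  exact this hx

theorem normalClosure_finite_set {K : Type*} [Group K] (S T : Set K) (hT : T.Finite)
    (hx : T ⊆ Subgroup.normalClosure S) :
    ∃ F : Set K, F.Finite ∧ F ⊆ S ∧ T ⊆ Subgroup.normalClosure F := by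
  choose F hF hFS hFx using fun t : T => normalClosure_finite S t.1 (hx t.2)
  have := hT.to_subtype
  refine ⟨⋃ t, F t, Set.finite_iUnion hF, Set.iUnion_subset hFS, fun t ht => ?_⟩
  exact Subgroup.normalClosure_mono (Set.subset_iUnion F ⟨t, ht⟩) (hFx ⟨t, ht⟩)

inductive AltWord {N P : Type*} [Group N] [Group P] (C : Subgroup N) (i : Bool → N →* P) :
    Bool → Bool → P → Prop
  | single (a : Bool) (n : N) (h : n ∉ C) : AltWord C i a a (i a n)
  | cons (a b : Bool) (n : N) (p : P) (h : n ∉ C) (hp : AltWord C i (!a) b p) :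
      AltWord C i a b (i a n * p)

theorem AltWord.absorb {N P : Type*} [Group N] [Group P] {C : Subgroup N} {i : Bool → N →* P}
    (hi : ∀ c ∈ C, i true c = i false c) {a b : Bool} {p : P} (h : AltWord C i a b p)
    (c : N) (hc : c ∈ C) (d : Bool) : AltWord C i a b (i d c * p) := by
  have hd : i d c = i a c := by cases a <;> cases d <;> simp [hi c hc]
  rw [hd]
  cases h with
  | single a n h =>
    rw [← map_mul]
    exact .single a _ fun h' => h ((C.mul_mem_cancel_left hc).1 h')
  | cons a b n p h hp =>
    rw [← mul_assoc, ← map_mul]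
    exact .cons a b _ p (fun h' => h ((C.mul_mem_cancel_left hc).1 h')) hp

theorem AltWord.mul {N P : Type*} [Group N] [Group P] {C : Subgroup N} {i : Bool → N →* P}
    (hi : ∀ c ∈ C, i true c = i false c) {p : P}
    (h : (∃ c ∈ C, p = i true c) ∨ ∃ a b, AltWord C i a b p) (d : Bool) (n : N) :
    (∃ c ∈ C, i d n * p = i true c) ∨ ∃ a b, AltWord C i a b (i d n * p) := by
  have hd : ∀ d, ∀ c ∈ C, i d c = i true c := by
    intro d c hc; cases d <;> simp [hi c hc]
  by_cases hn : n ∈ C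
  · rcases h with ⟨c, hc, rfl⟩ | ⟨a, b, h⟩
    · exact Or.inl ⟨n * c, mul_mem hn hc, by rw [hd d n hn, map_mul]⟩
    · exact Or.inr ⟨a, b, h.absorb hi n hn d⟩
  · rcases h with ⟨c, hc, rfl⟩ | ⟨a, b, h⟩
    · rw [← hd d c hc, ← map_mul]
      exact Or.inr ⟨d, d, .single d _ fun h' => hn ((C.mul_mem_cancel_right hc).1 h')⟩
    · by_cases had : a = !d
      · subst had
        exact Or.inr ⟨d, b, .cons d b n p hn h⟩
      · have had : a = d := by cases a <;> cases d <;> simp_all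
        subst had
        cases h with
        | single a m h =>
          rw [← map_mul]
          by_cases hm : n * m ∈ C
          · exact Or.inl ⟨_, hm, hd _ _ hm⟩
          · exact Or.inr ⟨a, a, .single a _ hm⟩
        | cons a b m p h hp =>
          rw [← mul_assoc, ← map_mul]
          by_cases hm : n * m ∈ C
          · exact Or.inr ⟨_, _, hp.absorb hi _ hm a⟩
          · exact Or.inr ⟨a, b, .cons a b _ p hm hp⟩

theorem AltWord.maps {N P G Ω : Type*} [Group N] [Group P] [Group G] [MulAction G Ω]
    {C : Subgroup N} {i : Bool → N →* P} (F : P →* G) (S : Bool → Set Ω)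
    (hp : ∀ a, ∀ n, n ∉ C → ∀ y ∈ S (!a), F (i a n) • y ∈ S a)
    {a b : Bool} {p : P} (h : AltWord C i a b p) : ∀ y ∈ S (!b), F p • y ∈ S a := by
  induction h with
  | single a n h => exact hp a n h
  | cons a b n p h _ ih =>
    intro y hy
    rw [map_mul, mul_smul]
    exact hp a n h _ (ih y hy)

theorem AltWord.ne_one {N P G Ω : Type*} [Group N] [Group P] [Group G] [MulAction G Ω]
    {C : Subgroup N} {i : Bool → N →* P} (F : P →* G) (S : Bool → Set Ω) (x : Bool → Ω)
    (hx : ∀ a, x a ∈ S a) (hdisj : ∀ a y, y ∈ S a → y ∉ S (!a))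
    (hp : ∀ a, ∀ n, n ∉ C → ∀ y ∈ S (!a), F (i a n) • y ∈ S a)
    (hb : ∀ a n, F (i a n) • x a ∉ S (!a))
    {a b : Bool} {p : P} (h : AltWord C i a b p) : F p ≠ 1 := by
  intro h1
  by_cases hab : a = b
  · subst hab
    have := h.maps F S hp (x (!a)) (hx _)
    rw [h1, one_smul] at this
    exact hdisj _ _ this (hx _)
  · cases h with
    | single a n h => exact hab rfl
    | cons a b n p h hpp =>
      have hb' : b = !a := by cases a <;> cases b <;> simp_all
      subst hb'
      have h2 := hpp.maps F S hp (x a) (by simpa using hx a)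
      rw [map_mul] at h1
      have h3 : F p = F (i a n⁻¹) := by
        rw [map_inv, map_inv]; exact (inv_eq_of_mul_eq_one_right h1).symm
      rw [h3] at h2
      exact hb _ _ h2

theorem amalgam_not_fp {N G Ω : Type*} [Group N] [Group G] [MulAction G Ω] [hN : Group.FG N]
    (C : Subgroup N) (hC : ¬ C.FG) (f : Bool → N →* G) (hf : ∀ c ∈ C, f true c = f false c)
    (S : Bool → Set Ω) (x : Bool → Ω)
    (hx : ∀ a, x a ∈ S a) (hdisj : ∀ a y, y ∈ S a → y ∉ S (!a))
    (hp : ∀ a, ∀ n, n ∉ C → ∀ y ∈ S (!a), f a n • y ∈ S a)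
    (hb : ∀ a n, f a n • x a ∉ S (!a)) (hinj : Function.Injective (f true)) :
    ∃ H : Subgroup G, Group.FG H ∧ ¬ IsFinitelyPresented H := by
  classical
  let π : Monoid.Coprod N N →* G := Monoid.Coprod.lift (f true) (f false)
  have hKfg : Group.FG (Monoid.Coprod N N) := by
    obtain ⟨X, hX, hXf⟩ := Group.fg_iff.1 hN
    refine Group.fg_iff.2 ⟨Monoid.Coprod.inl '' X ∪ Monoid.Coprod.inr '' X, ?_,
      (hXf.image _).union (hXf.image _)⟩
    rw [Subgroup.closure_union, ← MonoidHom.map_closure, ← MonoidHom.map_closure, hX,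
      ← MonoidHom.range_eq_map, ← MonoidHom.range_eq_map]
    exact Monoid.Coprod.range_inl_sup_range_inr
  refine ⟨π.range, Group.fg_of_surjective π.rangeRestrict_surjective, fun hfp => ?_⟩
  obtain ⟨T, hT, hker⟩ := ker_fng hfp π.rangeRestrict π.rangeRestrict_surjective
  rw [MonoidHom.ker_rangeRestrict] at hker
  let d : N → Monoid.Coprod N N := fun c => Monoid.Coprod.inl c * (Monoid.Coprod.inr c)⁻¹
  have hle : π.ker ≤ Subgroup.normalClosure (d '' C) := by
    let q := QuotientGroup.mk' (Subgroup.normalClosure (d '' C))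
    let i : Bool → N →* _ := fun b =>
      cond b (q.comp Monoid.Coprod.inl) (q.comp Monoid.Coprod.inr)
    have hi : ∀ c ∈ C, i true c = i false c := by
      intro c hc
      have : q (d c) = 1 := (QuotientGroup.eq_one_iff _).2
        (Subgroup.subset_normalClosure ⟨c, hc, rfl⟩)
      simp only [d, map_mul, map_inv, mul_inv_eq_one] at this
      exact this
    have hle' : Subgroup.normalClosure (d '' C) ≤ π.ker := by
      apply Subgroup.normalClosure_le_normal
      rintro _ ⟨c, hc, rfl⟩
      show π _ = 1
      simp [d, π, hf c hc]
    let F : _ →* G := QuotientGroup.lift _ π hle'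
    have hF : ∀ k, F (q k) = π k := fun k => rfl
    have hFi : ∀ a n, F (i a n) = f a n := by
      intro a n
      cases a <;> simp [i, hF, π]
    have hnf : ∀ k, (∃ c ∈ C, q k = i true c) ∨ ∃ a b, AltWord C i a b (q k) := by
      intro k
      induction k using Monoid.Coprod.induction_on' with
      | one => exact Or.inl ⟨1, one_mem _, by simp⟩
      | inl_mul m k ih => exact AltWord.mul hi ih true m
      | inr_mul m k ih => exact AltWord.mul hi ih false m
    intro k hk
    rcases hnf k with ⟨c, hc, h⟩ | ⟨a, b, h⟩
    · have h1 : F (q k) = 1 := hk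
      rw [h, hFi] at h1
      have : c = 1 := hinj (by rw [h1, map_one])
      subst this
      rw [map_one] at h
      exact (QuotientGroup.eq_one_iff _).1 h
    · exact absurd hk (h.ne_one F S x hx hdisj (by simpa [hFi] using hp) (by simpa [hFi] using hb))
  obtain ⟨F, hF, hFS, hTF⟩ := normalClosure_finite_set (d '' C) T hT (by
    intro t ht
    exact hle (hker ▸ Subgroup.subset_normalClosure ht))
  obtain ⟨F', hF'C, hF', rfl⟩ : ∃ F' : Set N, F' ⊆ C ∧ F'.Finite ∧ d '' F' = F := by
    obtain ⟨F', h1, h2, h3⟩ := (Set.exists_subset_image_finite_and (p := fun s => s = F)).1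
      ⟨F, hFS, hF, rfl⟩
    exact ⟨F', h1, h2, h3⟩
  let D := Subgroup.closure F'
  have hDC : D ≤ C := (Subgroup.closure_le _).2 hF'C
  have hDne : ∃ c ∈ C, c ∉ D := by
    by_contra hcon
    push Not at hcon
    have : C = D := le_antisymm hcon hDC
    exact hC (this ▸ (Subgroup.fg_iff _).2 ⟨F', rfl, hF'⟩)
  obtain ⟨c, hc, hcD⟩ := hDne
  -- permutation representation
  let f1 : N →* Equiv.Perm (Option (N ⧸ D)) :=
    { toFun := fun n => Equiv.optionCongr (MulAction.toPerm n)
      map_one' := by ext x; cases x <;> simp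
      map_mul' := by intro a b; ext x; cases x <;> simp [mul_smul] }
  let e : Equiv.Perm (Option (N ⧸ D)) := Equiv.swap none (some ((1 : N) : N ⧸ D))
  let f2 : N →* Equiv.Perm (Option (N ⧸ D)) := (MulAut.conj e).toMonoidHom.comp f1
  have hagree : ∀ n ∈ D, f1 n = f2 n := by
    intro n hn
    have h1 : f1 n (some ((1 : N) : N ⧸ D)) = some ((1 : N) : N ⧸ D) := by
      show some (((n * 1 : N)) : N ⧸ D) = _
      congr 1
      rw [QuotientGroup.eq]
      simpa using hn
    have h2 : f1 n none = none := rfl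
    have h3 : f1 n * e = e * f1 n := by
      have := Equiv.swap_apply_apply (f1 n) none (some ((1 : N) : N ⧸ D))
      rw [h1, h2] at this
      rw [eq_mul_inv_iff_mul_eq] at this
      exact this.symm
    show f1 n = e * f1 n * e⁻¹
    rw [← h3, mul_inv_cancel_right]
  let π' := Monoid.Coprod.lift f1 f2
  have hmem : d c ∈ π'.ker := by
    have h1 : d c ∈ π.ker := by
      show π _ = 1
      simp [d, π, hf c hc]
    rw [hker] at h1
    have h2 : Subgroup.normalClosure T ≤ Subgroup.normalClosure (d '' F') :=
      Subgroup.normalClosure_le_normal hTF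
    have h3 : Subgroup.normalClosure (d '' F') ≤ π'.ker := by
      apply Subgroup.normalClosure_le_normal
      rintro _ ⟨n, hn, rfl⟩
      show π' _ = 1
      simp [d, π', hagree n (Subgroup.subset_closure hn)]
    exact h3 (h2 h1)
  have heq : f1 c = f2 c := by
    have : π' (d c) = 1 := hmem
    simpa [d, π', mul_inv_eq_one] using this
  have h4 : f2 c (some ((1 : N) : N ⧸ D)) = some ((1 : N) : N ⧸ D) := by
    show e (f1 c (e⁻¹ _)) = _
    have : e⁻¹ (some ((1 : N) : N ⧸ D)) = none := by simp [e]
    rw [this]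
    show e none = _
    simp [e]
  rw [← heq] at h4
  have h5 : some ((c * 1 : N) : N ⧸ D) = some ((1 : N) : N ⧸ D) := h4
  rw [Option.some_inj, QuotientGroup.eq] at h5
  exact hcD (by simpa using h5)
end

section
def nbr : Fin 12 → List (Fin 12) :=
  ![[1,2,3,4,5], [0,2,3,6,7], [0,1,4,6,8], [0,1,5,7,9], [0,2,5,8,10], [0,3,4,9,10],
    [1,2,7,8,11], [1,3,6,9,11], [2,4,6,10,11], [3,5,7,10,11], [4,5,8,9,11], [6,7,8,9,10]]

def Adj (i j : Fin 12) : Prop := j ∈ nbr i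

instance (i j : Fin 12) : Decidable (Adj i j) := inferInstanceAs (Decidable (j ∈ nbr i))

theorem adj_symm : ∀ i j, Adj i j → Adj j i := by decide
theorem adj_irrefl : ∀ i, ¬ Adj i i := by decide

def CM : CoxeterMatrix (Fin 12) where
  M := Matrix.of fun i j => if i = j then 1 else if Adj i j then 2 else 0
  isSymm := by
    ext i j
    simp only [Matrix.transpose_apply, Matrix.of_apply]
    by_cases h : i = j
    · simp [h]
    · by_cases h2 : Adj i j
      · simp [h, h2, Ne.symm h, adj_symm _ _ h2]
      · have : ¬ Adj j i := fun h' => h2 (adj_symm _ _ h')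
        simp [h, h2, Ne.symm h, this]
  diagonal := by intro i; simp
  off_diagonal := by
    intro i j h
    simp only [Matrix.of_apply, h, if_false]
    split_ifs <;> simp

abbrev W := CM.Group
noncomputable abbrev cs : CoxeterSystem CM W := CM.toCoxeterSystem
noncomputable abbrev rr (i : Fin 12) : W := cs.simple i

theorem len_rr (w : W) (i : Fin 12) : cs.length (w * rr i) = cs.length w + 1 ∨
    cs.length (w * rr i) + 1 = cs.length w := cs.length_mul_simple w i

theorem rr_sq (i : Fin 12) : rr i * rr i = 1 := cs.simple_mul_simple_self i

theorem rr_inv (i : Fin 12) : (rr i)⁻¹ = rr i := cs.inv_simple i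

theorem CM_adj {i j : Fin 12} (h : Adj i j) : CM i j = 2 := by
  have : i ≠ j := by rintro rfl; exact adj_irrefl _ h
  show (if i = j then 1 else if Adj i j then 2 else 0) = 2
  simp [h, this]

theorem rr_comm {i j : Fin 12} (h : Adj i j) : rr i * rr j = rr j * rr i := by
  have h1 := cs.simple_mul_simple_pow i j
  rw [CM_adj h, pow_two] at h1
  have h2 := mul_eq_one_iff_eq_inv.1 h1
  rw [_root_.mul_inv_rev, rr_inv, rr_inv] at h2
  exact h2

theorem liftable {G : Type*} [Monoid G] (f : Fin 12 → G) (h2 : ∀ i, f i * f i = 1)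
    (hc : ∀ i j, Adj i j → f i * f j = f j * f i) : CM.IsLiftable f := by
  intro i j
  show (f i * f j) ^ (if i = j then 1 else if Adj i j then 2 else 0) = 1
  split_ifs with h h'
  · subst h; simp [h2]
  · rw [pow_two]; nth_rw 1 [hc i j h']
    rw [mul_assoc, ← mul_assoc (f i), h2, one_mul, h2]
  · simp

noncomputable def liftW {G : Type*} [Monoid G] (f : Fin 12 → G) (h2 : ∀ i, f i * f i = 1)
    (hc : ∀ i j, Adj i j → f i * f j = f j * f i) : W →* G :=
  cs.lift ⟨f, liftable f h2 hc⟩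

theorem liftW_rr {G : Type*} [Monoid G] (f : Fin 12 → G) (h2 : ∀ i, f i * f i = 1)
    (hc : ∀ i j, Adj i j → f i * f j = f j * f i) (i : Fin 12) : liftW f h2 hc (rr i) = f i :=
  cs.lift_apply_simple (liftable f h2 hc) i

theorem W_induction {p : W → Prop} (h1 : p 1) (h : ∀ w i, p w → p (w * rr i)) (w : W) : p w :=
  cs.simple_induction_right w h1 h

section Tits
variable {V : Type*} [AddCommGroup V] [Module ℝ V] (ρ : W →* (V →ₗ[ℝ] V)) (e : Fin 12 → V)
  (a : Fin 12 → Fin 12 → ℝ)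

theorem exists_descent {w : W} (h : w ≠ 1) : ∃ j, cs.length (w * rr j) < cs.length w := by
  obtain ⟨j, hj⟩ := cs.exists_rightDescent_of_ne_one h
  exact ⟨j, hj⟩

theorem tits (hρ : ∀ i j, ρ (rr j) (e i) = e i + a i j • e j)
    (hadj : ∀ i j, Adj i j → a i j = 0) (hself : ∀ i, a i i = -2)
    (hnon : ∀ i j, ¬ Adj i j → i ≠ j → 2 ≤ a i j)
    (f : V →ₗ[ℝ] ℝ) (hf : ∀ i, 0 ≤ f (e i)) (n : ℕ) :
    ∀ w : W, cs.length w ≤ n → ∀ i, cs.length w < cs.length (w * rr i) →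
      0 ≤ f (ρ w (e i)) ∧ ∀ j, ¬ Adj i j → i ≠ j → cs.length (w * rr j) < cs.length w →
        0 ≤ f (ρ w (e i)) + f (ρ w (e j)) := by
  induction n with
  | zero =>
    intro w hw i hi
    have hw1 : w = 1 := cs.length_eq_zero_iff.1 (Nat.le_zero.1 hw)
    subst hw1
    exact ⟨by simpa using hf i, fun j _ _ h => by simp at h⟩
  | succ n ih =>
    intro w hw i hi
    have key : ∀ j, ¬ Adj i j → i ≠ j → cs.length (w * rr j) < cs.length w →
        0 ≤ f (ρ w (e i)) ∧ 0 ≤ f (ρ w (e i)) + f (ρ w (e j)) := by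
      intro j hnadj hij hj
      obtain ⟨w', hw'⟩ : ∃ w', w' = w * rr j := ⟨_, rfl⟩
      have hww : w = w' * rr j := by rw [hw', mul_assoc, rr_sq, mul_one]
      rw [← hw'] at hj
      have hj' : cs.length w' < cs.length (w' * rr j) := by rw [← hww]; exact hj
      have e1 : ρ w (e i) = ρ w' (e i) + a i j • ρ w' (e j) := by
        rw [hww, map_mul, Module.End.mul_apply, hρ, map_add, map_smul]
      have e2 : ρ w (e j) = - ρ w' (e j) := by
        rw [hww, map_mul, Module.End.mul_apply, hρ, map_add, map_smul, hself]; module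
      obtain ⟨p1, p2⟩ := ih w' (by omega) j hj'
      have ha := hnon i j hnadj hij
      have hsum : 0 ≤ f (ρ w' (e i)) + f (ρ w' (e j)) := by
        rcases lt_or_ge (cs.length w') (cs.length (w' * rr i)) with h | h
        · exact add_nonneg (ih w' (by omega) i h).1 p1
        · have h' : cs.length (w' * rr i) < cs.length w' := by
            rcases len_rr w' i with h'' | h'' <;> omega
          have := p2 i (fun h => hnadj (adj_symm _ _ h)) hij.symm h'
          linarith
      rw [e1, e2]
      simp only [map_add, map_smul, map_neg, smul_eq_mul]
      constructor <;> nlinarith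
    refine ⟨?_, fun j h1 h2 h3 => (key j h1 h2 h3).2⟩
    by_cases hw1 : w = 1
    · subst hw1; simpa using hf i
    obtain ⟨j, hj⟩ := exists_descent hw1
    have hij : i ≠ j := by rintro rfl; omega
    by_cases hadj' : Adj i j
    · obtain ⟨w', hw'⟩ : ∃ w', w' = w * rr j := ⟨_, rfl⟩
      have hww : w = w' * rr j := by rw [hw', mul_assoc, rr_sq, mul_one]
      rw [← hw'] at hj
      have e1 : ρ w (e i) = ρ w' (e i) := by
        rw [hww, map_mul, Module.End.mul_apply, hρ, hadj i j hadj', zero_smul, add_zero]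
      rw [e1]
      refine (ih w' (by omega) i ?_).1
      have h1 : w * rr i = w' * rr i * rr j := by
        rw [hww, mul_assoc, mul_assoc, rr_comm hadj']
      rw [h1] at hi
      rcases len_rr (w' * rr i) j with h'' | h'' <;>
      rcases len_rr w' i with h3 | h3 <;> omega
    · exact (key j hadj' hij hj).1

theorem tits_descent (hρ : ∀ i j, ρ (rr j) (e i) = e i + a i j • e j)
    (hadj : ∀ i j, Adj i j → a i j = 0) (hself : ∀ i, a i i = -2)
    (hnon : ∀ i j, ¬ Adj i j → i ≠ j → 2 ≤ a i j)
    (f : V →ₗ[ℝ] ℝ) (hf : ∀ i, 0 ≤ f (e i)) (w : W) (j : Fin 12)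
    (hj : cs.length (w * rr j) < cs.length w) : f (ρ w (e j)) ≤ 0 := by
  have hww : w = w * rr j * rr j := by rw [mul_assoc, rr_sq, mul_one]
  have h1 := (tits ρ e a hρ hadj hself hnon f hf _ (w * rr j) le_rfl j (by rwa [← hww])).1
  rw [map_mul, Module.End.mul_apply, hρ, hself] at h1
  simp only [map_add, map_smul, smul_eq_mul] at h1
  linarith

theorem tits_faithful (hρ : ∀ i j, ρ (rr j) (e i) = e i + a i j • e j)
    (hadj : ∀ i j, Adj i j → a i j = 0) (hself : ∀ i, a i i = -2)
    (hnon : ∀ i j, ¬ Adj i j → i ≠ j → 2 ≤ a i j)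
    (f : V →ₗ[ℝ] ℝ) (hf : ∀ i, 0 < f (e i)) (w : W) (hw : ρ w = 1) : w = 1 := by
  by_contra h
  obtain ⟨j, hj⟩ := exists_descent h
  have := tits_descent ρ e a hρ hadj hself hnon f (fun i => (hf i).le) w j hj
  rw [hw] at this
  have h2 := hf j
  simp at this
  linarith
end Tits

noncomputable section Abs

def av (i j : Fin 12) : ℝ := if i = j then -2 else if Adj i j then 0 else 2

def ae (i : Fin 12) : Fin 12 → ℝ := Pi.single i 1

def arefl (j : Fin 12) : (Fin 12 → ℝ) →ₗ[ℝ] (Fin 12 → ℝ) :=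
  LinearMap.id + (∑ i, av i j • LinearMap.proj i : (Fin 12 → ℝ) →ₗ[ℝ] ℝ).smulRight (ae j)

theorem arefl_ae (i j : Fin 12) : arefl j (ae i) = ae i + av i j • ae j := by
  simp [arefl, ae, Pi.single_apply]

theorem arefl_apply (j : Fin 12) (x : Fin 12 → ℝ) : ∃ c : ℝ, arefl j x = x + c • ae j :=
  ⟨_, rfl⟩

theorem ae_ext {f g : (Fin 12 → ℝ) →ₗ[ℝ] (Fin 12 → ℝ)} (h : ∀ i, f (ae i) = g (ae i)) : f = g :=
  LinearMap.pi_ext' fun i => LinearMap.ext_ring (h i)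

theorem av_self (i : Fin 12) : av i i = -2 := by simp [av]
theorem av_adj (i j : Fin 12) (h : Adj i j) : av i j = 0 := by
  have : i ≠ j := by rintro rfl; exact adj_irrefl _ h
  simp [av, this, h]
theorem av_non (i j : Fin 12) (h : ¬ Adj i j) (hij : i ≠ j) : av i j = 2 := by simp [av, h, hij]

def aρ : W →* ((Fin 12 → ℝ) →ₗ[ℝ] (Fin 12 → ℝ)) :=
  liftW (G := Module.End ℝ (Fin 12 → ℝ)) arefl
    (fun i => ae_ext fun k => by
      rw [Module.End.mul_apply, arefl_ae, map_add, map_smul, arefl_ae, arefl_ae, av_self,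
        Module.End.one_apply]; module)
    (fun i j h => ae_ext fun k => by
      rw [Module.End.mul_apply, Module.End.mul_apply, arefl_ae, arefl_ae, map_add, map_add,
        map_smul, map_smul, arefl_ae, arefl_ae, arefl_ae, arefl_ae, av_adj i j h,
        av_adj j i (adj_symm _ _ h)]
      module)

theorem aρ_rr (i : Fin 12) : aρ (rr i) = arefl i := liftW_rr _ _ _ i

theorem fix_mem (k : Fin 12) (n : ℕ) : ∀ w : W, cs.length w ≤ n → ∀ c : ℝ, 0 < c →
    aρ w (ae k) = c • ae k → w ∈ Subgroup.closure {g | ∃ j, Adj k j ∧ g = rr j} := by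
  have hρ : ∀ i j, aρ (rr j) (ae i) = ae i + av i j • ae j := fun i j => by
    rw [aρ_rr, arefl_ae]
  have T := fun m => tits aρ ae av hρ av_adj av_self (fun i j h h' => (av_non i j h h').ge)
    (LinearMap.proj m) (fun i => by simp only [ae, LinearMap.proj_apply, Pi.single_apply]; split_ifs <;> norm_num)
  have D := fun m => tits_descent aρ ae av hρ av_adj av_self (fun i j h h' => (av_non i j h h').ge)
    (LinearMap.proj m) (fun i => by simp only [ae, LinearMap.proj_apply, Pi.single_apply]; split_ifs <;> norm_num)
  induction n with
  | zero =>
    intro w hw c hc h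
    rw [cs.length_eq_zero_iff.1 (Nat.le_zero.1 hw)]
    exact one_mem _
  | succ n ih =>
    intro w hw c hc h
    by_cases hw1 : w = 1
    · rw [hw1]; exact one_mem _
    have hup : cs.length w < cs.length (w * rr k) := by
      by_contra hcon
      have h' : cs.length (w * rr k) < cs.length w := by
        rcases len_rr w k with h'' | h'' <;> omega
      have := D k w k h'
      rw [h] at this
      simp [ae] at this
      linarith
    obtain ⟨j, hj⟩ := exists_descent hw1
    have hkj : k ≠ j := by rintro rfl; omega
    obtain ⟨w', hw'⟩ : ∃ w', w' = w * rr j := ⟨_, rfl⟩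
    have hww : w = w' * rr j := by rw [hw', mul_assoc, rr_sq, mul_one]
    rw [← hw'] at hj
    have e1 : aρ w (ae k) = aρ w' (ae k) + av k j • aρ w' (ae j) := by
      rw [hww, map_mul, Module.End.mul_apply, hρ, map_add, map_smul]
    have e2 : aρ w (ae j) = - aρ w' (ae j) := by
      rw [hww, map_mul, Module.End.mul_apply, hρ, map_add, map_smul, av_self]; module
    by_cases hadj' : Adj k j
    · have h1 : w' ∈ _ := ih w' (by omega) c hc (by
        rw [← h, e1, av_adj _ _ hadj', zero_smul, add_zero])
      rw [hww]
      exact mul_mem h1 (Subgroup.subset_closure ⟨j, hadj', rfl⟩)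
    · exfalso
      have hz : ∀ m, m ≠ k → aρ w' (ae j) m = 0 := by
        intro m hm
        have q1 := (T m _ w le_rfl k hup).2 j hadj' hkj (by rwa [← hw'])
        have q2 := D m w j (by rwa [← hw'])
        rw [h, e2] at q1
        rw [e2] at q2
        have q3 : (c • ae k) m = 0 := by simp [ae, hm]
        simp only [LinearMap.proj_apply, Pi.neg_apply, q3] at q1 q2
        linarith
      obtain ⟨c2, hc2⟩ : ∃ c2 : ℝ, aρ w' (ae j) = c2 • ae k := by
        refine ⟨aρ w' (ae j) k, ?_⟩
        ext m
        by_cases hm : m = k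
        · subst hm; simp [ae]
        · rw [hz m hm]; simp [ae, hm]
      have h0 : aρ w (c2 • ae k + c • ae j) = 0 := by
        rw [map_add, map_smul, map_smul, h, e2, hc2]; module
      have h0' : aρ w⁻¹ (aρ w (c2 • ae k + c • ae j)) = 0 := by rw [h0, map_zero]
      rw [← Module.End.mul_apply, ← map_mul, inv_mul_cancel, map_one, Module.End.one_apply] at h0'
      have := congrFun h0' j
      simp [ae, hkj.symm] at this
      linarith

theorem comm_mem (k : Fin 12) (w : W) (h : w * rr k = rr k * w) :
    w ∈ Subgroup.closure {g | ∃ j, Adj k j ∧ g = rr j} ∨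
    w * rr k ∈ Subgroup.closure {g | ∃ j, Adj k j ∧ g = rr j} := by
  obtain ⟨c, hc⟩ : ∃ c : ℝ, aρ w (ae k) = c • ae k := by
    have h1 : aρ (w * rr k) (ae k) = aρ (rr k * w) (ae k) := by rw [h]
    rw [map_mul, map_mul, Module.End.mul_apply, Module.End.mul_apply, aρ_rr, arefl_ae, av_self,
      map_add, map_smul] at h1
    obtain ⟨c, hc⟩ := arefl_apply k (aρ w (ae k))
    rw [hc] at h1
    refine ⟨-c / 2, ?_⟩
    have h2 : (-2 : ℝ) • aρ w (ae k) = c • ae k := add_left_cancel h1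
    calc _ = (-1/2 : ℝ) • ((-2 : ℝ) • aρ w (ae k)) := by module
      _ = _ := by rw [h2]; module
  rcases lt_trichotomy c 0 with h1 | h1 | h1
  · right
    refine fix_mem k _ _ le_rfl (-c) (by linarith) ?_
    rw [map_mul, Module.End.mul_apply, aρ_rr, arefl_ae, av_self, map_add, map_smul, hc]
    module
  · exfalso
    have h0' : aρ w⁻¹ (aρ w (ae k)) = 0 := by rw [hc, h1, zero_smul, map_zero]
    rw [← Module.End.mul_apply, ← map_mul, inv_mul_cancel, map_one, Module.End.one_apply] at h0'
    have := congrFun h0' k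
    simp [ae] at this
  · left; exact fix_mem k _ _ le_rfl c h1 hc
end Abs
end

section
def stTab : Fin 32 → ℕ :=
  ![185, 248, 411, 474, 1085, 1148, 1311, 1374, 2485, 2548, 2199, 2262, 3377, 3440, 3091, 3154,
    2721, 2784, 2947, 3010, 3621, 3684, 3847, 3910, 941, 1004, 655, 718, 1833, 1896, 1547, 1610]
def parTab : Fin 32 → ℕ :=
  ![0x68b636000660, 0x88a837353822, 0xbbb41b900600, 0x955666581065, 0x647611000010,
    0x747b72445471, 0x747277900000, 0x945292521225, 0x8938b1483832, 0x693262423233,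
    0x7aaa18a05111, 0x655a11525115, 0x843411441114, 0x843418440000, 0xa47677347604,
    0xbb323b0a0060, 0x945292521225, 0x747277900000, 0x747b72445471, 0x647611000010,
    0x955666581065, 0xbbb41b900600, 0x88a837353822, 0x68b636000660, 0xbb323b0a0060,
    0xa47677347604, 0x843418440000, 0x843411441114, 0x655a11525115, 0x7aaa18a05111,
    0x693262423233, 0x8938b1483832]
def rootTab : Bool → Fin 32 → Fin 12
  | false => ![6, 8, 11, 5, 1, 7, 7, 5, 3, 3, 10, 5, 1, 0, 7, 0, 2, 0, 4, 0, 6, 0, 3, 0, 11, 4, 4,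
      4, 1, 1, 2, 8]
  | true => ![0, 3, 0, 6, 0, 4, 0, 2, 8, 2, 1, 1, 4, 4, 4, 11, 5, 7, 7, 1, 5, 11, 8, 6, 0, 7, 0, 1,
      5, 10, 3, 3]
def mv : Fin 12 → Fin 32 := ![1, 2, 4, 8, 16, 2, 1, 4, 2, 24, 4, 10]

def inS (i : Fin 12) (x : Fin 32) : Bool := (stTab x).testBit i
def par (x : Fin 32) (i : Fin 12) : Fin 12 := Fin.ofNat 12 ((parTab x >>> (4 * i.1)) % 16)

theorem inS_self : ∀ i x, inS i (x ^^^ mv i) = !inS i x := by decide +kernel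
theorem inS_adj : ∀ i j, Adj i j → ∀ x, inS j (x ^^^ mv i) = inS j x := by decide +kernel
theorem xor_xor : ∀ x y : Fin 32, x ^^^ y ^^^ y = x := by decide +kernel
theorem xor_swap : ∀ (x : Fin 32) (i j : Fin 12), x ^^^ mv i ^^^ mv j = x ^^^ mv j ^^^ mv i := by
  decide +kernel
theorem par_adj : ∀ x i, (par x i = i ∨ Adj i (par x i)) ∧ inS (par x i) x = inS i x := by
  decide +kernel
theorem par_root : ∀ x i, par x (par x i) = rootTab (inS i x) x := by decide +kernel
theorem inS_root : ∀ s x, inS (rootTab s x) x = s := by decide +kernel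

theorem rtg_symm {α : Type*} {r : α → α → Prop} (hr : ∀ x y, r x y → r y x) {x y : α}
    (h : Relation.ReflTransGen r x y) : Relation.ReflTransGen r y x := by
  induction h with
  | refl => exact .refl
  | tail _ h2 ih => exact .head (hr _ _ h2) ih

theorem rtg_mono {α : Type*} {r r' : α → α → Prop} (hr : ∀ x y, r x y → r' x y) {x y : α}
    (h : Relation.ReflTransGen r x y) : Relation.ReflTransGen r' x y := by
  induction h with
  | refl => exact .refl
  | tail _ h2 ih => exact .tail ih (hr _ _ h2)

theorem conn_state (x : Fin 32) (i i' : Fin 12) (h : inS i x = inS i' x) :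
    Relation.ReflTransGen (fun p q => Adj p q ∧ inS p x = inS i x ∧ inS q x = inS i x) i i' := by
  have step : ∀ p, inS p x = inS i x → Relation.ReflTransGen
      (fun p q => Adj p q ∧ inS p x = inS i x ∧ inS q x = inS i x) p (par x p) := by
    intro p hp
    obtain ⟨h1 | h1, h2⟩ := par_adj x p
    · rw [h1]
    · exact .single ⟨h1, hp, h2.trans hp⟩
  have toroot : ∀ p, inS p x = inS i x → Relation.ReflTransGen
      (fun p q => Adj p q ∧ inS p x = inS i x ∧ inS q x = inS i x) p (rootTab (inS i x) x) := by
    intro p hp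
    have := par_root x p
    rw [hp] at this
    rw [← this]
    exact (step p hp).trans (step _ ((par_adj x p).2.trans hp))
  exact (toroot i rfl).trans (rtg_symm (fun p q h => ⟨adj_symm _ _ h.1, h.2.2, h.2.1⟩)
    (toroot i' h.symm))

def sg (b : Bool) : ℤ := if b then 1 else -1

def actf (i : Fin 12) (p : ℤ × Fin 32) : ℤ × Fin 32 := (p.1 + sg (inS i p.2), p.2 ^^^ mv i)

theorem actf_sq (i : Fin 12) (p : ℤ × Fin 32) : actf i (actf i p) = p := by
  ext1
  · simp only [actf, inS_self]
    cases inS i p.2 <;> simp [sg]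
  · exact xor_xor _ _

theorem actf_comm (i j : Fin 12) (h : Adj i j) (p : ℤ × Fin 32) :
    actf i (actf j p) = actf j (actf i p) := by
  ext1
  · simp only [actf, inS_adj _ _ h, inS_adj _ _ (adj_symm _ _ h)]
    ring
  · exact xor_swap _ _ _

noncomputable def actW : W →* Function.End (ℤ × Fin 32) :=
  liftW (G := Function.End (ℤ × Fin 32)) actf (fun i => funext fun p => actf_sq i p)
    (fun i j h => funext fun p => actf_comm i j h p)

theorem actW_rr (i : Fin 12) (p) : actW (rr i) p = actf i p := by
  rw [show actW (rr i) = actf i from liftW_rr _ _ _ i]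

theorem actW_mul (u v : W) (p) : actW (u * v) p = actW u (actW v p) := by
  rw [map_mul]; rfl
theorem actW_one (p) : actW 1 p = p := by rw [map_one]; rfl

theorem actW_inv_eq (u : W) (p q) : actW u⁻¹ p = q ↔ p = actW u q := by
  constructor
  · rintro rfl; rw [← actW_mul, mul_inv_cancel, actW_one]
  · rintro rfl; rw [← actW_mul, inv_mul_cancel, actW_one]

def x0 : ℤ × Fin 32 := (0, 0)

noncomputable def pos (w : W) : ℤ × Fin 32 := actW w⁻¹ x0

theorem pos_rr (w : W) (i : Fin 12) : pos (w * rr i) = actf i (pos w) := by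
  rw [pos, _root_.mul_inv_rev, rr_inv, actW_mul, actW_rr]; rfl

theorem pos_one : pos 1 = x0 := by rw [pos, inv_one, actW_one]

noncomputable def Nst : Subgroup W where
  carrier := {w | actW w x0 = x0}
  one_mem' := actW_one x0
  mul_mem' := by
    intro a b ha hb
    show actW (a * b) x0 = x0
    rw [actW_mul, show actW b x0 = x0 from hb]; exact ha
  inv_mem' := by
    intro a ha
    show actW a⁻¹ x0 = x0
    rw [actW_inv_eq]; exact ha.symm

theorem mem_Nst {w : W} : w ∈ Nst ↔ actW w x0 = x0 := Iff.rfl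

theorem pos_mem {w : W} : w ∈ Nst ↔ pos w = x0 := by
  rw [mem_Nst, pos, actW_inv_eq]; exact eq_comm

theorem pos_eq {u v : W} (h : pos u = pos v) : u * v⁻¹ ∈ Nst := by
  rw [mem_Nst, actW_mul]
  rw [pos, actW_inv_eq] at h
  exact h.symm

/-- signed height -/
noncomputable def gh (s : Bool) (w : W) : ℤ := - sg s * (pos w).1

def stp (s : Bool) (a b : ℤ) (u v : W) : Prop :=
  ∃ i, v = u * rr i ∧ a ≤ gh s u ∧ gh s u ≤ b ∧ a ≤ gh s v ∧ gh s v ≤ b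

theorem stp_symm (s : Bool) (a b : ℤ) : ∀ u v, stp s a b u v → stp s a b v u := by
  rintro u v ⟨i, rfl, h1, h2, h3, h4⟩
  exact ⟨i, by rw [mul_assoc, rr_sq, mul_one], h3, h4, h1, h2⟩

theorem rstp_symm (s : Bool) (a b : ℤ) {u v} (h : Relation.ReflTransGen (stp s a b) u v) :
    Relation.ReflTransGen (stp s a b) v u :=
  rtg_symm (stp_symm s a b) h

theorem gh_rr (s : Bool) (w : W) (i : Fin 12) :
    gh s (w * rr i) = gh s w - sg s * sg (inS i (pos w).2) := by
  rw [gh, gh, pos_rr]; simp only [actf]; ring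

theorem inS_rr_adj (w : W) {i j : Fin 12} (h : Adj i j) :
    inS j (pos (w * rr i)).2 = inS j (pos w).2 := by
  rw [pos_rr]; exact inS_adj _ _ h _

theorem sg_mul_self (s : Bool) : sg s * sg s = 1 := by cases s <;> rfl
theorem sg_mul_ne {s t : Bool} (h : t ≠ s) : sg s * sg t = -1 := by
  cases s <;> cases t <;> simp_all [sg]

theorem top_conn (s : Bool) (a b : ℤ) (hab : a + 2 ≤ b) (u : W) (hu : gh s u = b)
    (i i' : Fin 12) (hi : inS i (pos u).2 = s) (hi' : inS i' (pos u).2 = s) :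
    Relation.ReflTransGen (stp s a (b - 1)) (u * rr i) (u * rr i') := by
  have h := conn_state (pos u).2 i i' (hi.trans hi'.symm)
  rw [hi] at h
  clear hi'
  induction h with
  | refl => exact .refl
  | @tail p q _ hpq ih =>
    obtain ⟨hadj, hp, hq⟩ := hpq
    have g1 : gh s (u * rr p) = b - 1 := by rw [gh_rr, hp, sg_mul_self, hu]
    have g2 : gh s (u * rr q) = b - 1 := by rw [gh_rr, hq, sg_mul_self, hu]
    have g3 : gh s (u * rr p * rr q) = b - 2 := by
      rw [gh_rr, inS_rr_adj u hadj, hq, sg_mul_self, g1]; ring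
    refine (ih.tail ⟨q, rfl, ?_⟩).tail ⟨p, ?_, ?_⟩
    · rw [g1, g3]; omega
    · rw [mul_assoc u, rr_comm hadj, mul_assoc, mul_assoc, rr_sq, mul_one]
    · rw [g2, g3]; omega

open Classical in
noncomputable def low (s : Bool) (b : ℤ) (u : W) : W :=
  if gh s u = b then u * rr (rootTab s (pos u).2) else u

theorem low_step (s : Bool) (a b : ℤ) (hab : a + 2 ≤ b) (u v : W) (h : stp s a b u v) :
    Relation.ReflTransGen (stp s a (b - 1)) (low s b u) (low s b v) := by
  have top : ∀ u i, gh s u = b → gh s (u * rr i) ≤ b →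
      Relation.ReflTransGen (stp s a (b - 1)) (low s b u) (low s b (u * rr i)) := by
    intro u i hu hv
    have hi : inS i (pos u).2 = s := by
      by_contra hne
      rw [gh_rr, sg_mul_ne hne, hu] at hv
      omega
    have hne : gh s (u * rr i) ≠ b := by
      rw [gh_rr, hi, sg_mul_self, hu]; omega
    rw [low, if_pos hu, low, if_neg hne]
    exact top_conn s a b hab u hu _ _ (inS_root _ _) hi
  obtain ⟨i, rfl, h1, h2, h3, h4⟩ := h
  by_cases hu : gh s u = b
  · exact top u i hu h4
  · by_cases hv : gh s (u * rr i) = b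
    · have := top (u * rr i) i hv (by rwa [mul_assoc, rr_sq, mul_one])
      rw [mul_assoc, rr_sq, mul_one] at this
      exact rstp_symm _ _ _ this
    · rw [low, if_neg hu, low, if_neg hv]
      exact .single ⟨i, rfl, h1, by omega, h3, by omega⟩

theorem low_reduce (s : Bool) (a b : ℤ) (hab : a + 2 ≤ b) (u v : W) (hu : gh s u < b)
    (hv : gh s v < b) (h : Relation.ReflTransGen (stp s a b) u v) :
    Relation.ReflTransGen (stp s a (b - 1)) u v := by
  have h1 : Relation.ReflTransGen (stp s a (b - 1)) (low s b u) (low s b v) := by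
    clear hv
    induction h with
    | refl => exact .refl
    | tail _ h2 ih => exact ih.trans (low_step s a b hab _ _ h2)
  rwa [low, if_neg hu.ne, low, if_neg hv.ne] at h1

theorem low_reduce_many (s : Bool) (a b : ℤ) (hab : a + 1 ≤ b) (n : ℕ) (u v : W) (hu : gh s u ≤ b)
    (hv : gh s v ≤ b) (h : Relation.ReflTransGen (stp s a (b + n)) u v) :
    Relation.ReflTransGen (stp s a b) u v := by
  induction n with
  | zero => simpa using h
  | succ n ih =>
    apply ih
    have := low_reduce s a (b + (n + 1 : ℕ)) (by push_cast; omega) u v (by push_cast; omega)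
      (by push_cast; omega) h
    convert this using 2
    push_cast; ring

theorem stp_flip (s : Bool) (a b : ℤ) (u v : W) (h : stp s a b u v) : stp (!s) (-b) (-a) u v := by
  have : ∀ w, gh (!s) w = - gh s w := by
    intro w; cases s <;> simp [gh, sg]
  obtain ⟨i, h0, h1, h2, h3, h4⟩ := h
  refine ⟨i, h0, ?_⟩
  rw [this, this]; omega

theorem stp_mono (s : Bool) {a b a' b' : ℤ} (ha : a' ≤ a) (hb : b ≤ b') (u v : W)
    (h : stp s a b u v) : stp s a' b' u v := by
  obtain ⟨i, h0, h1, h2, h3, h4⟩ := h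
  exact ⟨i, h0, by omega⟩

theorem exists_path (w : W) : ∃ n : ℕ, Relation.ReflTransGen (stp false (-n) (1 + n)) 1 w := by
  induction w using W_induction with
  | h1 => exact ⟨0, .refl⟩
  | h w i ih =>
    obtain ⟨n, hn⟩ := ih
    refine ⟨n + (gh false w).natAbs + (gh false (w * rr i)).natAbs,
      (rtg_mono (stp_mono _ ?_ ?_) hn).tail ⟨i, rfl, ?_⟩⟩ <;> omega

theorem conn01 (w : W) (hw : w ∈ Nst) : Relation.ReflTransGen (stp false 0 1) 1 w := by
  obtain ⟨n, hn⟩ := exists_path w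
  have h1 : ∀ s, gh s 1 = 0 := fun s => by rw [gh, pos_one]; simp [x0]
  have h2 : ∀ s, gh s w = 0 := fun s => by rw [gh, pos_mem.1 hw]; simp [x0]
  have a1 := low_reduce_many false (-n) 1 (by omega) n 1 w (by rw [h1]; omega)
    (by rw [h2]; omega) hn
  have a2 : Relation.ReflTransGen (stp true (-1) (0 + n)) 1 w :=
    rtg_mono (fun u v h => by simpa using stp_flip _ _ _ u v h) a1
  have a3 := low_reduce_many true (-1) 0 (by omega) n 1 w (by rw [h1])
    (by rw [h2]) a2
  exact rtg_mono (fun u v h => by simpa using stp_flip _ _ _ u v h) a3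

theorem Nst_fg : Nst.FG := by
  classical
  choose! τ hτ using fun (x : ℤ × Fin 32) (h : ∃ w, pos w = x) => h
  have hτ' : ∀ w, pos (τ (pos w)) = pos w := fun w => hτ _ ⟨w, rfl⟩
  let Gs : Set W := {τ x0} ∪ (fun p : (ℤ × Fin 32) × Fin 12 => τ p.1 * rr p.2 * (τ (actf p.2 p.1))⁻¹) ''
    {p | (p.1.1 = 0 ∨ p.1.1 = 1) ∧ ∃ w, pos w = p.1}
  have hfin : Gs.Finite := by
    refine (Set.finite_singleton _).union (Set.Finite.image _ ?_)
    refine Set.Finite.subset (s := ((({0, 1} : Set ℤ) ×ˢ Set.univ) ×ˢ Set.univ)) ?_ ?_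
    · exact Set.Finite.prod (Set.Finite.prod (by simp) Set.finite_univ) Set.finite_univ
    · rintro p ⟨hp, _⟩
      simpa using hp
  refine (Subgroup.fg_iff _).2 ⟨Gs, le_antisymm ?_ ?_, hfin⟩
  · rw [Subgroup.closure_le]
    rintro _ (rfl | ⟨⟨x, i⟩, ⟨_, w, hw⟩, rfl⟩)
    · have := hτ' 1
      rw [pos_one] at this
      exact pos_mem.2 this
    · refine pos_eq ?_
      dsimp only at hw
      subst hw
      dsimp only
      rw [pos_rr, hτ', ← pos_rr, hτ']
  · intro n hn
    have key : ∀ u, Relation.ReflTransGen (stp false 0 1) 1 u →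
        u * (τ (pos u))⁻¹ ∈ Subgroup.closure Gs := by
      intro u hu
      induction hu with
      | refl =>
        rw [pos_one, one_mul]
        exact inv_mem (Subgroup.subset_closure (Or.inl rfl))
      | @tail p q _ hpq ih =>
        obtain ⟨i, rfl, h1, h2, _⟩ := hpq
        have : p * rr i * (τ (pos (p * rr i)))⁻¹ =
            (p * (τ (pos p))⁻¹) * (τ (pos p) * rr i * (τ (actf i (pos p)))⁻¹) := by
          rw [pos_rr]; group
        rw [this]
        refine mul_mem ih (Subgroup.subset_closure (Or.inr ⟨(pos p, i), ⟨?_, p, rfl⟩, rfl⟩))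
        simp only [gh, sg] at h1 h2
        simp at h1 h2 ⊢
        omega
    have := key n (conn01 n hn)
    rw [pos_mem.1 hn] at this
    have h2 := mul_mem this (Subgroup.subset_closure (Or.inl rfl) : τ x0 ∈ Subgroup.closure Gs)
    simpa using h2
end

section
noncomputable section Lamp

def chi (j : Fin 12) (x : Fin 32) : ℤ := if inS j x then 0 else 1

def bs (p : ℤ × Fin 32) : ℤ := p.1 - chi 2 p.2 - chi 1 p.2 - chi 4 p.2

abbrev YY := (ℤ × Fin 32) × (ℤ → ℤ)

def lampAdd (j : Fin 12) (p : ℤ × Fin 32) : ℤ → ℤ :=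
  if j = 2 then Pi.single (bs p) (sg (inS 2 p.2)) else 0

def lampf (j : Fin 12) (y : YY) : YY :=
  if Adj 0 j then (actf j y.1, y.2 + lampAdd j y.1) else y

theorem chi_adj (i j : Fin 12) (h : Adj i j) (x : Fin 32) : chi j (x ^^^ mv i) = chi j x := by
  rw [chi, inS_adj i j h]; rfl

theorem chi_self (i : Fin 12) (x : Fin 32) :
    sg (inS i x) - chi i (x ^^^ mv i) = - chi i x := by
  rw [chi, chi, inS_self]; cases inS i x <;> simp [sg]

theorem chi41 : ∀ x, chi 4 (x ^^^ mv 1) = chi 4 x := by decide +kernel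
theorem chi14 : ∀ x, chi 1 (x ^^^ mv 4) = chi 1 x := by decide +kernel

theorem bs_2 (p : ℤ × Fin 32) : bs (actf 2 p) = bs p := by
  simp only [bs, actf]
  rw [chi_adj 2 1 (by decide), chi_adj 2 4 (by decide)]
  linarith [chi_self 2 p.2]
theorem bs_1 (p : ℤ × Fin 32) : bs (actf 1 p) = bs p := by
  simp only [bs, actf]
  rw [chi_adj 1 2 (by decide), chi41]
  linarith [chi_self 1 p.2]
theorem bs_4 (p : ℤ × Fin 32) : bs (actf 4 p) = bs p := by
  simp only [bs, actf]
  rw [chi_adj 4 2 (by decide), chi14]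
  linarith [chi_self 4 p.2]

theorem lampAdd_comm : ∀ j, Adj 0 j → Adj 2 j → ∀ p, lampAdd 2 (actf j p) = lampAdd 2 p := by
  intro j h0 h2 p
  have hj : j = 1 ∨ j = 4 := by revert j; decide
  have hb : bs (actf j p) = bs p := by
    rcases hj with rfl | rfl
    · exact bs_1 p
    · exact bs_4 p
  simp only [lampAdd, if_true]
  rw [hb]
  simp only [actf]
  rw [inS_adj j 2 (adj_symm _ _ h2)]

theorem lampf_sq (i : Fin 12) (y : YY) : lampf i (lampf i y) = y := by
  by_cases h : Adj 0 i
  · simp only [lampf, h, if_true]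
    ext1
    · exact actf_sq i y.1
    · show y.2 + lampAdd i y.1 + lampAdd i (actf i y.1) = y.2
      by_cases h2 : i = 2
      · subst h2
        simp only [lampAdd, if_true]
        rw [bs_2]
        simp only [actf]
        rw [inS_self, add_assoc, ← Pi.single_add]
        cases inS 2 y.1.2 <;> simp [sg]
      · simp [lampAdd, h2]
  · simp [lampf, h]

theorem lampf_comm (i j : Fin 12) (hij : Adj i j) (y : YY) :
    lampf i (lampf j y) = lampf j (lampf i y) := by
  by_cases hi : Adj 0 i <;> by_cases hj : Adj 0 j <;> simp only [lampf, hi, hj, if_true, if_false]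
  ext1
  · exact actf_comm i j hij y.1
  · show y.2 + lampAdd j y.1 + lampAdd i (actf j y.1) = y.2 + lampAdd i y.1 + lampAdd j (actf i y.1)
    by_cases h2 : i = 2
    · subst h2
      have : j ≠ 2 := by rintro rfl; exact adj_irrefl _ hij
      rw [lampAdd_comm j hj hij]
      simp [lampAdd, this]
    · by_cases h3 : j = 2
      · subst h3
        rw [lampAdd_comm i hi (adj_symm _ _ hij)]
        simp [lampAdd, h2]
      · simp [lampAdd, h2, h3]

def lampW : W →* Function.End YY :=
  liftW (G := Function.End YY) lampf (fun i => funext fun p => lampf_sq i p)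
    (fun i j h => funext fun p => lampf_comm i j h p)

theorem lampW_rr (i : Fin 12) (p) : lampW (rr i) p = lampf i p := by
  rw [show lampW (rr i) = lampf i from liftW_rr _ _ _ i]

theorem lampW_mul (u v : W) (p) : lampW (u * v) p = lampW u (lampW v p) := by
  rw [map_mul]; rfl
theorem lampW_one (p) : lampW 1 p = p := by rw [map_one]; rfl

theorem lampW_inv_eq (u : W) (p q) : lampW u⁻¹ p = q ↔ p = lampW u q := by
  constructor
  · rintro rfl; rw [← lampW_mul, mul_inv_cancel, lampW_one]
  · rintro rfl; rw [← lampW_mul, inv_mul_cancel, lampW_one]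

theorem lampf_add (i : Fin 12) (p) (L L' : ℤ → ℤ) :
    lampf i (p, L + L') = ((lampf i (p, L)).1, (lampf i (p, L)).2 + L') := by
  simp only [lampf]; split_ifs
  · simp only [Prod.mk.injEq, true_and]; abel
  · rfl

theorem lampW_add (w : W) : ∀ (p) (L L' : ℤ → ℤ),
    lampW w (p, L + L') = ((lampW w (p, L)).1, (lampW w (p, L)).2 + L') := by
  induction w using W_induction with
  | h1 => intro p L L'; simp [lampW_one]
  | h w i ih =>
    intro p L L'
    rw [lampW_mul, lampW_rr, lampf_add, ih, lampW_mul, lampW_rr]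

theorem lampW_support (w : W) : ∀ y : YY, ∃ B : ℕ, ∀ b : ℤ, b < -B → (lampW w y).2 b = y.2 b := by
  induction w using W_induction with
  | h1 => intro y; exact ⟨0, fun b _ => by rw [lampW_one]⟩
  | h w i ih =>
    intro y
    obtain ⟨B, hB⟩ := ih (lampf i y)
    refine ⟨B + (bs y.1).natAbs, fun b hb => ?_⟩
    rw [lampW_mul, lampW_rr, hB b (by omega)]
    simp only [lampf, lampAdd]
    split_ifs
    · have : b ≠ bs y.1 := by omega
      simp [this]
    · simp
    · rfl

def pent : Subgroup W := Subgroup.closure {g | ∃ j, Adj 0 j ∧ g = rr j}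

theorem lampW_pos (w : W) (hw : w ∈ pent) : ∀ y : YY, (lampW w y).1 = actW w y.1 := by
  induction hw using Subgroup.closure_induction with
  | mem x hx =>
    obtain ⟨j, hj, rfl⟩ := hx
    intro y
    rw [lampW_rr, actW_rr, lampf, if_pos hj]
  | one => intro y; rw [lampW_one, actW_one]
  | mul x y _ _ hx hy => intro y; rw [lampW_mul, actW_mul, hx, hy]
  | inv x _ hx =>
    intro y
    symm
    rw [actW_inv_eq, ← hx, ← lampW_mul, mul_inv_cancel, lampW_one]

def c0 : W := rr 2 * rr 5 * rr 2 * rr 5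
def pp : W := rr 1 * rr 5

theorem lampW_c0 (z : ℤ) (L : ℤ → ℤ) :
    lampW c0 ((z, 0), L) = ((z, 0), L + (Pi.single (z - 2) 1 - Pi.single z 1)) := by
  simp only [c0, lampW_mul, lampW_rr]
  have h5 : Adj 0 5 := by decide
  have h2 : Adj 0 2 := by decide
  have i1 : inS 5 0 = true := by decide +kernel
  have m1 : (0 : Fin 32) ^^^ mv 5 = 2 := by decide +kernel
  have i2 : inS 2 2 = false := by decide +kernel
  have m2 : (2 : Fin 32) ^^^ mv 2 = 6 := by decide +kernel
  have i3 : inS 5 6 = false := by decide +kernel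
  have m3 : (6 : Fin 32) ^^^ mv 5 = 4 := by decide +kernel
  have i4 : inS 2 4 = true := by decide +kernel
  have m4 : (4 : Fin 32) ^^^ mv 2 = 0 := by decide +kernel
  have k1 : inS 1 2 = true := by decide +kernel
  have k2 : inS 4 2 = true := by decide +kernel
  have k3 : inS 1 4 = false := by decide +kernel
  have k4 : inS 4 4 = true := by decide +kernel
  have n52 : (5 : Fin 12) ≠ 2 := by decide
  simp only [lampf, h5, h2, if_true, actf, lampAdd, n52, if_false, i1, m1, i2, m2, i3, m3, i4, m4,
    bs, chi, k1, k2, k3, k4, sg, if_true, Bool.false_eq_true, add_zero]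
  ext b
  · simp
  · rfl
  · have : Pi.single (M := fun _ : ℤ => ℤ) z (-1) = - Pi.single z 1 := by
      rw [Pi.single_neg]
    have e1 : z + 1 - 1 - 0 - 0 = z := by ring
    have e2 : z + 1 + -1 + -1 - 0 - 1 - 0 = z - 2 := by ring
    simp only [e1, e2, this, Pi.add_apply, Pi.sub_apply, Pi.neg_apply]
    ring

theorem lampW_ppinv (z : ℤ) (L : ℤ → ℤ) : lampW pp⁻¹ ((z, 0), L) = ((z - 2, 0), L) := by
  have : pp⁻¹ = rr 5 * rr 1 := by rw [pp, _root_.mul_inv_rev, rr_inv, rr_inv]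
  simp only [this, lampW_mul, lampW_rr]
  have h5 : Adj 0 5 := by decide
  have h1 : Adj 0 1 := by decide
  have n52 : (5 : Fin 12) ≠ 2 := by decide
  have n12 : (1 : Fin 12) ≠ 2 := by decide
  have i1 : inS 1 0 = false := by decide +kernel
  have m1 : (0 : Fin 32) ^^^ mv 1 = 2 := by decide +kernel
  have i2 : inS 5 2 = false := by decide +kernel
  have m2 : (2 : Fin 32) ^^^ mv 5 = 0 := by decide +kernel
  simp only [lampf, h5, h1, if_true, actf, lampAdd, n52, n12, if_false, i1, m1, i2, m2, sg,
    Bool.false_eq_true, add_zero]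
  ext1
  · ext1
    · simp only; ring
    · rfl
  · rfl

theorem lampW_ppinv_pow (k : ℕ) : ∀ (z : ℤ) (L : ℤ → ℤ),
    lampW (pp ^ k)⁻¹ ((z, 0), L) = ((z - 2 * k, 0), L) := by
  induction k with
  | zero => intro z L; simp [lampW_one]
  | succ k ih =>
    intro z L
    rw [pow_succ', _root_.mul_inv_rev, lampW_mul, lampW_ppinv, ih]
    push_cast
    congr 2; ring

theorem lampW_c0_pow (m : ℕ) (z : ℤ) : ∀ (L : ℤ → ℤ),
    lampW (c0 ^ m) ((z, 0), L) =
      ((z, 0), L + (m : ℤ) • (Pi.single (z - 2) 1 - Pi.single z 1)) := by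
  induction m with
  | zero => intro L; simp [lampW_one]
  | succ m ih =>
    intro L
    rw [pow_succ, lampW_mul, lampW_c0, ih]
    push_cast
    congr 1
    rw [add_smul, one_smul, add_assoc, add_comm (_ - _)]

theorem lampW_conj (m k : ℕ) : lampW (pp ^ k * c0 ^ m * (pp ^ k)⁻¹) (x0, 0) =
    (x0, (m : ℤ) • (Pi.single (-(2 * k : ℤ) - 2) 1 - Pi.single (-(2 * k : ℤ)) 1)) := by
  rw [lampW_mul, lampW_mul, x0, lampW_ppinv_pow, lampW_c0_pow]
  have h := lampW_ppinv_pow k 0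
    ((m : ℤ) • (Pi.single (-(2 * k : ℤ) - 2) 1 - Pi.single (-(2 * k : ℤ)) 1))
  rw [lampW_inv_eq] at h
  rw [h]; simp

theorem conj_mem_pent (m k : ℕ) : pp ^ k * c0 ^ m * (pp ^ k)⁻¹ ∈ pent := by
  have h : ∀ j, Adj 0 j → rr j ∈ pent := fun j hj => Subgroup.subset_closure ⟨j, hj, rfl⟩
  have h1 := h 1 (by decide)
  have h2 := h 2 (by decide)
  have h5 := h 5 (by decide)
  have hp : pp ∈ pent := mul_mem h1 h5
  have hc : c0 ∈ pent := mul_mem (mul_mem (mul_mem h2 h5) h2) h5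
  exact mul_mem (mul_mem (pow_mem hp _) (pow_mem hc _)) (inv_mem (pow_mem hp _))

theorem conj_mem_Nst (m k : ℕ) : pp ^ k * c0 ^ m * (pp ^ k)⁻¹ ∈ Nst := by
  rw [mem_Nst]
  have := lampW_pos _ (conj_mem_pent m k) (x0, 0)
  rw [lampW_conj] at this
  exact this.symm

def Kb (b : ℤ) : Subgroup W where
  carrier := {w | (lampW w (x0, 0)).1 = x0 ∧ (lampW w (x0, 0)).2 b = 0}
  one_mem' := by simp [lampW_one]
  mul_mem' := by
    rintro u v ⟨hu1, hu2⟩ ⟨hv1, hv2⟩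
    have h1 : lampW v (x0, 0) = (x0, (lampW v (x0, 0)).2) := Prod.ext hv1 rfl
    have h2 := lampW_add u x0 0 (lampW v (x0, 0)).2
    rw [zero_add] at h2
    show (lampW (u * v) (x0, 0)).1 = x0 ∧ (lampW (u * v) (x0, 0)).2 b = 0
    rw [lampW_mul, h1, h2]
    exact ⟨hu1, by simp [hu2, hv2]⟩
  inv_mem' := by
    rintro u ⟨hu1, hu2⟩
    have h2 := lampW_add u x0 0 (-(lampW u (x0, 0)).2)
    rw [zero_add, hu1, add_neg_cancel] at h2
    have h3 := (lampW_inv_eq u (x0, 0) (x0, -(lampW u (x0, 0)).2)).2 h2.symm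
    show (lampW u⁻¹ (x0, 0)).1 = x0 ∧ (lampW u⁻¹ (x0, 0)).2 b = 0
    rw [h3]
    exact ⟨rfl, by simp [hu2]⟩

theorem not_fg_of (D : Subgroup W) (hD1 : D ≤ Nst) (hD2 : D ≤ pent) (m : ℕ) (hm : m ≠ 0)
    (hD : ∀ k : ℕ, pp ^ k * c0 ^ m * (pp ^ k)⁻¹ ∈ D) : ¬ D.FG := by
  intro hfg
  obtain ⟨F, hF, hfin⟩ := (Subgroup.fg_iff _).1 hfg
  choose B hB using fun w => lampW_support w (x0, 0)
  obtain ⟨k, hk⟩ : ∃ k : ℕ, ∀ w ∈ F, B w ≤ k := by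
    obtain ⟨k, hk⟩ := (hfin.image B).bddAbove
    exact ⟨k, fun w hw => hk ⟨w, hw, rfl⟩⟩
  have hle : D ≤ Kb (-(2 * k : ℤ) - 2) := by
    rw [← hF, Subgroup.closure_le]
    intro w hw
    have hwD : w ∈ D := hF ▸ Subgroup.subset_closure hw
    refine ⟨?_, ?_⟩
    · rw [lampW_pos w (hD2 hwD)]; exact hD1 hwD
    · rw [hB w _ (by have := hk w hw; omega)]; rfl
  have := (hle (hD k)).2
  rw [lampW_conj] at this
  simp at this
  exact hm this
end Lamp
end

section
abbrev Rq := QuadraticAlgebra ℤ 1 1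

def evq {A : Type*} [CommRing A] (u : A) (hu : u * u = 1 + u) : Rq →+* A where
  toFun z := z.re + z.im * u
  map_one' := by simp [QuadraticAlgebra.re_one, QuadraticAlgebra.im_one]
  map_zero' := by simp
  map_add' x y := by
    simp only [QuadraticAlgebra.re_add, QuadraticAlgebra.im_add]; push_cast; ring
  map_mul' x y := by
    simp only [QuadraticAlgebra.re_mul, QuadraticAlgebra.im_mul]; push_cast
    linear_combination (-(x.im : A) * y.im) * hu

theorem evq_apply {A : Type*} [CommRing A] (u : A) (hu : u * u = 1 + u) (z : Rq) :
    evq u hu z = z.re + z.im * u := rfl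

def gd : Fin 5 → Rq := ![⟨0, -1⟩, 1, 1, 1, 1]

def evt : Fin 12 → Fin 5 → Rq :=
  ![![0, -1, 0, 0, 0], ![0, 0, -1, 0, 0], ![0, 0, 0, -1, 0],
    ![1, 0, 0, ⟨0, 1⟩, 0], ![1, 0, ⟨0, 1⟩, 0, 0], ![⟨0, 1⟩, 0, ⟨0, 1⟩, ⟨0, 1⟩, 0],
    ![1, ⟨0, 1⟩, 0, 0, 0], ![⟨0, 1⟩, ⟨0, 1⟩, 0, ⟨0, 1⟩, 0], ![⟨0, 1⟩, ⟨0, 1⟩, ⟨0, 1⟩, 0, 0],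
    ![⟨1, 1⟩, ⟨0, 1⟩, ⟨0, 1⟩, ⟨1, 1⟩, 0], ![⟨1, 1⟩, ⟨0, 1⟩, ⟨1, 1⟩, ⟨0, 1⟩, 0],
    ![⟨1, 1⟩, ⟨1, 1⟩, ⟨0, 1⟩, ⟨0, 1⟩, 0]]

def Gd : Matrix (Fin 5) (Fin 5) Rq := Matrix.diagonal gd

def Rm (i : Fin 12) : Matrix (Fin 5) (Fin 5) Rq :=
  Matrix.of fun a b => (if a = b then 1 else 0) - 2 * evt i a * (gd b * evt i b)

def aR (i j : Fin 12) : Rq := - 2 * (∑ a, evt i a * (gd a * evt j a))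

set_option maxRecDepth 100000 in
theorem Rm_sq : ∀ i, Rm i * Rm i = 1 := by decide +kernel
set_option maxRecDepth 100000 in
theorem Rm_comm : ∀ i j, Adj i j → Rm i * Rm j = Rm j * Rm i := by decide +kernel
set_option maxRecDepth 100000 in
theorem Rm_orth : ∀ i, (Rm i)ᵀ * Gd * Rm i = Gd := by decide +kernel
set_option maxRecDepth 100000 in
theorem Rm_ev : ∀ i j, Rm j *ᵥ evt i = evt i + aR i j • evt j := by decide +kernel
set_option maxRecDepth 100000 in
theorem aR_self : ∀ i, aR i i = -2 := by decide +kernel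
set_option maxRecDepth 100000 in
theorem aR_adj : ∀ i j, Adj i j → aR i j = 0 := by decide +kernel
set_option maxRecDepth 100000 in
theorem aR_non : ∀ i j, ¬ Adj i j → i ≠ j → aR i j = ⟨0, 2⟩ ∨ aR i j = ⟨2, 2⟩ ∨ aR i j = 2 := by
  decide +kernel

def lamq (v : Fin 5 → Rq) : Rq := ⟨0, 2⟩ * v 0 - v 1 - v 2 - v 3

set_option maxRecDepth 100000 in
theorem lam_ev : ∀ i, 0 ≤ (lamq (evt i)).re ∧ 0 ≤ (lamq (evt i)).im ∧ lamq (evt i) ≠ 0 := by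
  decide +kernel
set_option maxRecDepth 100000 in
theorem Rm_row4 : ∀ i j, Rm i 4 j = (1 : Matrix (Fin 5) (Fin 5) Rq) 4 j := by decide +kernel

def ssw : Matrix (Fin 5) (Fin 5) Rq :=
  !![1,0,0,0,0; 0,0,0,0,1; 0,0,1,0,0; 0,0,0,1,0; 0,1,0,0,0]
theorem ssw_sq : ssw * ssw = 1 := by decide +kernel
theorem ssw_orth : sswᵀ * Gd * ssw = Gd := by decide +kernel
theorem ssw_comm : ∀ j, Adj 0 j → ssw * Rm j = Rm j * ssw := by decide +kernel
theorem Rm_zero : Rm 0 = Matrix.diagonal ![1, -1, 1, 1, 1] := by decide +kernel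
theorem Rm_col1 : ∀ j, Adj 0 j → ∀ a, Rm j a 1 = (1 : Matrix (Fin 5) (Fin 5) Rq) a 1 := by
  decide +kernel

abbrev GL5 := GL (Fin 5) Rq

def Ru (i : Fin 12) : GL5 := ⟨Rm i, Rm i, Rm_sq i, Rm_sq i⟩
def su : GL5 := ⟨ssw, ssw, ssw_sq, ssw_sq⟩

noncomputable def rho : W →* GL5 :=
  liftW Ru (fun i => Units.ext (Rm_sq i)) (fun i j h => Units.ext (Rm_comm i j h))

theorem rho_rr (i : Fin 12) : rho (rr i) = Ru i := liftW_rr _ _ _ i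
end

section
theorem s5 : Real.sqrt 5 * Real.sqrt 5 = 5 := Real.mul_self_sqrt (by norm_num)
theorem s5_lo : 2 < Real.sqrt 5 := by
  rw [show (2:ℝ) = Real.sqrt 4 by rw [show (4:ℝ) = 2^2 by norm_num]; simp]
  exact Real.sqrt_lt_sqrt (by norm_num) (by norm_num)

noncomputable def phi : ℝ := (1 + Real.sqrt 5) / 2
noncomputable def phj : ℝ := (1 - Real.sqrt 5) / 2

theorem phi_sq : phi * phi = 1 + phi := by unfold phi; linear_combination s5 / 4
theorem phj_sq : phj * phj = 1 + phj := by unfold phj; linear_combination s5 / 4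
theorem phi_gt : 1 < phi := by unfold phi; linarith [s5_lo]
theorem phj_lt : phj < 0 := by unfold phj; linarith [s5_lo]

noncomputable def tau : Rq →+* ℝ := evq phi phi_sq
noncomputable def sig : Rq →+* ℝ := evq phj phj_sq

theorem tau_apply (z : Rq) : tau z = z.re + z.im * phi := rfl
theorem sig_apply (z : Rq) : sig z = z.re + z.im * phj := rfl

theorem tau_sig (z : Rq) : tau z * sig z = ((z.re * z.re + z.re * z.im - z.im * z.im : ℤ) : ℝ) := by
  rw [tau_apply, sig_apply]; push_cast
  unfold phi phj
  linear_combination (-(z.im : ℝ) * z.im / 4) * s5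

theorem norm_zero (a b : ℤ) (h : a * a + a * b - b * b = 0) : a = 0 ∧ b = 0 := by
  have h5 : Irrational (Real.sqrt 5) := by
    have := Nat.Prime.irrational_sqrt (show Nat.Prime 5 by norm_num)
    exact_mod_cast this
  by_cases hb : b = 0
  · subst hb; simpa using h
  · exfalso
    have h1 : (2 * a + b) * (2 * a + b) = 5 * (b * b) := by linear_combination 4 * h
    have h2 : IsSquare (5 : ℚ) := by
      refine ⟨(2 * a + b) / b, ?_⟩
      have hb' : (b : ℚ) ≠ 0 := by exact_mod_cast hb
      field_simp
      have : ((2 * a + b : ℚ)) * (2 * a + b) = 5 * (b * b) := by exact_mod_cast h1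
      linear_combination -this
    obtain ⟨q, hq⟩ := h2
    apply h5
    refine ⟨|q|, ?_⟩
    rw [eq_comm, Real.sqrt_eq_iff_mul_self_eq (by norm_num) (by positivity)]
    have : (5:ℝ) = q * q := by exact_mod_cast hq
    push_cast
    rw [abs_mul_abs_self (q : ℝ)]; linarith

theorem nm_ge (z : Rq) (hz : z ≠ 0) : 1 ≤ |tau z| * |sig z| := by
  rw [← abs_mul, tau_sig]
  have h : z.re * z.re + z.re * z.im - z.im * z.im ≠ 0 := by
    intro h
    obtain ⟨h1, h2⟩ := norm_zero _ _ h
    exact hz (QuadraticAlgebra.ext h1 h2)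
  exact_mod_cast Int.one_le_abs h

theorem tau_inj : Function.Injective tau := by
  rw [injective_iff_map_eq_zero]
  intro z h
  by_contra hz
  have := nm_ge z hz
  rw [h] at this; simp at this; linarith

theorem sig_inj : Function.Injective sig := by
  rw [injective_iff_map_eq_zero]
  intro z h
  by_contra hz
  have := nm_ge z hz
  rw [h] at this; simp at this; linarith

noncomputable def rhoV : W →* ((Fin 5 → ℝ) →ₗ[ℝ] (Fin 5 → ℝ)) :=
  ((Matrix.toLinAlgEquiv' (R := ℝ) (n := Fin 5)).toRingEquiv.toRingHom.toMonoidHom.comp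
    ((tau.mapMatrix (m := Fin 5)).toMonoidHom.comp ((Units.coeHom _).comp rho)))

theorem rhoV_apply (w : W) (x : Fin 5 → ℝ) :
    rhoV w x = ((rho w : Matrix (Fin 5) (Fin 5) Rq).map tau) *ᵥ x := rfl

noncomputable def lamV : (Fin 5 → ℝ) →ₗ[ℝ] ℝ :=
  (2 * phi) • LinearMap.proj 0 - LinearMap.proj 1 - LinearMap.proj 2 - LinearMap.proj 3

theorem lamV_apply (v : Fin 5 → Rq) : lamV (fun a => tau (v a)) = tau (lamq v) := by
  simp only [lamV, lamq, map_sub, map_mul, LinearMap.sub_apply, LinearMap.smul_apply,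
    LinearMap.proj_apply, smul_eq_mul]
  rw [show tau ⟨0, 2⟩ = 2 * phi by rw [tau_apply]; simp]

theorem rho_inj : Function.Injective rho := by
  rw [injective_iff_map_eq_one]
  intro w hw
  refine tits_faithful (ρ := rhoV) (e := fun i a => tau (evt i a)) (a := fun i j => tau (aR i j))
    ?_ ?_ ?_ ?_ (f := lamV) ?_ w ?_
  · intro i j
    rw [rhoV_apply, rho_rr]
    have h := Rm_ev i j
    ext a
    have h2 := congrFun h a
    have h3 := congrArg tau h2
    simp only [Matrix.mulVec, dotProduct, map_sum, map_mul, Pi.add_apply, map_add, Pi.smul_apply,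
      smul_eq_mul] at h3
    simpa [Matrix.mulVec, dotProduct, Ru] using h3
  · intro i j h
    simp only [aR_adj i j h, map_zero]
  · intro i
    simp only [aR_self i, map_neg, map_ofNat]
  · intro i j h hij
    have := phi_gt
    rcases aR_non i j h hij with h | h | h <;> simp only [h, tau_apply]
    · simp; linarith
    · simp; linarith
    · rw [← tau_apply, map_ofNat]
  · intro i
    rw [lamV_apply]
    obtain ⟨h1, h2, h3⟩ := lam_ev i
    have h4 : 0 ≤ tau (lamq (evt i)) := by
      rw [tau_apply]
      have := phi_gt
      have h1' : (0:ℝ) ≤ (lamq (evt i)).re := by exact_mod_cast h1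
      have h2' : (0:ℝ) ≤ (lamq (evt i)).im := by exact_mod_cast h2
      positivity
    refine lt_of_le_of_ne h4 fun h => h3 (tau_inj ?_)
    rw [← h, map_zero]
  · ext1 x
    rw [rhoV, MonoidHom.comp_apply, MonoidHom.comp_apply, MonoidHom.comp_apply, hw, map_one, map_one, map_one]

/-- row four -/
theorem rho_row4 (w : W) : ∀ j, (rho w : Matrix (Fin 5) (Fin 5) Rq) 4 j
    = (1 : Matrix (Fin 5) (Fin 5) Rq) 4 j := by
  induction w using W_induction with
  | h1 => intro j; simp
  | h w i ih =>
    intro j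
    rw [map_mul, rho_rr, Units.val_mul, Matrix.mul_apply]
    simp only [ih]
    rw [← Matrix.mul_apply, one_mul]
    exact Rm_row4 i j

def OGd : Subgroup GL5 where
  carrier := {M | (M : Matrix (Fin 5) (Fin 5) Rq)ᵀ * Gd * (M : Matrix (Fin 5) (Fin 5) Rq) = Gd}
  one_mem' := by simp
  mul_mem' := by
    intro a b ha hb
    simp only [Set.mem_ofPred_eq] at *
    rw [Units.val_mul, Matrix.transpose_mul]
    calc _ = (b : Matrix (Fin 5) (Fin 5) Rq)ᵀ * ((a : Matrix (Fin 5) (Fin 5) Rq)ᵀ * Gd * a) * b := by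
          simp only [Matrix.mul_assoc]
      _ = _ := by rw [ha, hb]
  inv_mem' := by
    intro a ha
    simp only [Set.mem_ofPred_eq] at *
    have h : (a : Matrix (Fin 5) (Fin 5) Rq) * ((a⁻¹ : GL5) : Matrix (Fin 5) (Fin 5) Rq) = 1 := a.mul_inv
    set N := ((a⁻¹ : GL5) : Matrix (Fin 5) (Fin 5) Rq)
    calc Nᵀ * Gd * N = Nᵀ * ((a : Matrix (Fin 5) (Fin 5) Rq)ᵀ * Gd * a) * N := by rw [ha]
      _ = ((a : Matrix (Fin 5) (Fin 5) Rq) * N)ᵀ * Gd * (a * N) := by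
        rw [Matrix.transpose_mul]; simp only [Matrix.mul_assoc]
      _ = Gd := by rw [h]; simp

theorem rho_mem (w : W) : rho w ∈ OGd := by
  induction w using W_induction with
  | h1 => simp [OGd.one_mem]
  | h w i ih =>
    rw [map_mul, rho_rr]
    exact OGd.mul_mem ih (Rm_orth i)

theorem su_mem : su ∈ OGd := ssw_orth

theorem pent_comm (w : W) (h : w ∈ pent) : su * rho w = rho w * su := by
  have : pent ≤ (Subgroup.centralizer {su}).comap rho := by
    rw [pent, Subgroup.closure_le]
    rintro _ ⟨j, hj, rfl⟩
    simp only [SetLike.mem_coe, Subgroup.mem_comap, rho_rr, Subgroup.mem_centralizer_singleton_iff]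
    exact Units.ext (ssw_comm j hj).symm
  have := this h
  rw [Subgroup.mem_comap, Subgroup.mem_centralizer_singleton_iff] at this
  exact this.symm

theorem pent_col1 (w : W) (h : w ∈ pent) : ∀ a, (rho w : Matrix (Fin 5) (Fin 5) Rq) a 1
    = (1 : Matrix (Fin 5) (Fin 5) Rq) a 1 := by
  induction h using Subgroup.closure_induction_right with
  | one => simp
  | mul_right x _ y hy ih =>
    obtain ⟨j, hj, rfl⟩ := hy
    intro a
    rw [map_mul, rho_rr, Units.val_mul, Matrix.mul_apply]
    simp only [show (Ru j : Matrix (Fin 5) (Fin 5) Rq) = Rm j from rfl, Rm_col1 j hj]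
    rw [← Matrix.mul_apply, mul_one, ih]
  | mul_inv_cancel x _ y hy ih =>
    obtain ⟨j, hj, rfl⟩ := hy
    intro a
    rw [rr_inv, map_mul, rho_rr, Units.val_mul, Matrix.mul_apply]
    simp only [show (Ru j : Matrix (Fin 5) (Fin 5) Rq) = Rm j from rfl, Rm_col1 j hj]
    rw [← Matrix.mul_apply, mul_one, ih]
end

section
theorem rev_cs (p c0 c2 c3 x0 x2 x3 : ℝ) (hp : 0 < p) (hB : 0 < p * c0 ^ 2 - c2 ^ 2 - c3 ^ 2) :
    (p * x0 ^ 2 - x2 ^ 2 - x3 ^ 2) * (p * c0 ^ 2 - c2 ^ 2 - c3 ^ 2)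
      ≤ (p * c0 * x0 - c2 * x2 - c3 * x3) ^ 2 := by
  have hc0 : 0 < c0 ^ 2 := by
    have : 0 < p * c0 ^ 2 := by nlinarith [sq_nonneg c2, sq_nonneg c3]
    exact pos_of_mul_pos_right this hp.le
  have key : c0 ^ 2 * ((p * c0 * x0 - c2 * x2 - c3 * x3) ^ 2 -
      (p * x0 ^ 2 - x2 ^ 2 - x3 ^ 2) * (p * c0 ^ 2 - c2 ^ 2 - c3 ^ 2)) =
      (p * c0 ^ 2 - c2 ^ 2 - c3 ^ 2) * ((c0 * x2 - x0 * c2) ^ 2 + (c0 * x3 - x0 * c3) ^ 2)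
       + (c2 * (c0 * x2 - x0 * c2) + c3 * (c0 * x3 - x0 * c3)) ^ 2 := by ring
  have h0 : 0 ≤ c0 ^ 2 * ((p * c0 * x0 - c2 * x2 - c3 * x3) ^ 2 -
      (p * x0 ^ 2 - x2 ^ 2 - x3 ^ 2) * (p * c0 ^ 2 - c2 ^ 2 - c3 ^ 2)) := by
    rw [key]; positivity
  have := nonneg_of_mul_nonneg_right h0 hc0
  linarith

theorem pp_real (p c0 b c2 c3 x0 x1 x2 x3 x4 : ℝ) (hp : 0 < p)
    (hc : -p * c0 ^ 2 + b ^ 2 + c2 ^ 2 + c3 ^ 2 = 1) (hb : 3 ≤ |b|)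
    (hx : -p * x0 ^ 2 + x1 ^ 2 + x2 ^ 2 + x3 ^ 2 + x4 ^ 2 < 0) (h14 : |x1| < |x4|) :
    |x4| < |-p * c0 * x0 + b * x1 + c2 * x2 + c3 * x3| := by
  have hb2 : b ^ 2 = |b| ^ 2 := (sq_abs b).symm
  have h1 : x1 ^ 2 = |x1| ^ 2 := (sq_abs x1).symm
  have h4 : x4 ^ 2 = |x4| ^ 2 := (sq_abs x4).symm
  have hB : 0 < p * c0 ^ 2 - c2 ^ 2 - c3 ^ 2 := by nlinarith
  have h := rev_cs p c0 c2 c3 x0 x2 x3 hp hB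
  have hB' : p * c0 ^ 2 - c2 ^ 2 - c3 ^ 2 = |b| ^ 2 - 1 := by linarith
  set Y := p * c0 * x0 - c2 * x2 - c3 * x3 with hY
  have hBB : 0 < |b| ^ 2 - 1 := by rw [← hB']; exact hB
  have hA : (|x1| ^ 2 + |x4| ^ 2) * (|b| ^ 2 - 1) < Y ^ 2 := by
    refine lt_of_lt_of_le ?_ h
    rw [hB']
    apply mul_lt_mul_of_pos_right _ hBB
    linarith
  have hX : 0 ≤ |x1| := abs_nonneg _
  have h2 : (|x4| + |b| * |x1|) ^ 2 < |Y| ^ 2 := by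
    rw [sq_abs]
    refine lt_of_le_of_lt ?_ hA
    nlinarith [mul_nonneg (mul_nonneg (sub_nonneg.2 hb) (by positivity : 0 ≤ |b| + 1))
      (sq_nonneg |x4|), mul_nonneg (sub_nonneg.2 h14.le) hX,
      mul_nonneg (abs_nonneg b) (mul_nonneg (sub_nonneg.2 h14.le) (abs_nonneg x4)),
      mul_nonneg (sub_nonneg.2 h14.le) (abs_nonneg x4)]
  have h3 : |x4| + |b| * |x1| < |Y| := lt_of_pow_lt_pow_left₀ 2 (abs_nonneg _) h2
  have h5 : |Y| ≤ |-p * c0 * x0 + b * x1 + c2 * x2 + c3 * x3| + |b * x1| := by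
    have : Y = b * x1 - (-p * c0 * x0 + b * x1 + c2 * x2 + c3 * x3) := by rw [hY]; ring
    rw [this]
    have := abs_sub (b * x1) (-p * c0 * x0 + b * x1 + c2 * x2 + c3 * x3)
    linarith
  rw [abs_mul] at h5
  linarith

abbrev Q10 := QuadraticAlgebra (ZMod 10) 1 1

instance : Finite Q10 := Finite.of_equiv _ (QuadraticAlgebra.equivProd (1 : ZMod 10) 1).symm

def redq : Rq →+* Q10 := evq ⟨0, 1⟩ (by decide +kernel)

theorem redq_zero (x : Rq) (h : redq x = 0) : ∃ y, x = 10 * y := by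
  have h1 : redq x = ⟨x.re, x.im⟩ := by
    rw [redq, evq_apply]
    ext <;> simp
  rw [h1] at h
  have h2 : ((x.re : ℤ) : ZMod 10) = 0 := congrArg QuadraticAlgebra.re h
  have h3 : ((x.im : ℤ) : ZMod 10) = 0 := congrArg QuadraticAlgebra.im h
  obtain ⟨a, ha⟩ := (ZMod.intCast_zmod_eq_zero_iff_dvd _ 10).1 h2
  obtain ⟨b, hb⟩ := (ZMod.intCast_zmod_eq_zero_iff_dvd _ 10).1 h3
  refine ⟨⟨a, b⟩, ?_⟩
  have h10 : (10 : Rq) = ⟨10, 0⟩ := by decide +kernel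
  rw [h10]
  ext
  · simp [ha]
  · simp [hb]

noncomputable def redG : GL5 →* GL (Fin 5) Q10 := Matrix.GeneralLinearGroup.map redq

instance : Finite (GL (Fin 5) Q10) := by
  have : Finite (Matrix (Fin 5) (Fin 5) Q10) := inferInstanceAs (Finite (Fin 5 → Fin 5 → Q10))
  exact inferInstanceAs (Finite (Matrix (Fin 5) (Fin 5) Q10)ˣ)

theorem redG_ker (g : GL5) (h : redG g = 1) :
    ∃ X : Matrix (Fin 5) (Fin 5) Rq, (g : Matrix (Fin 5) (Fin 5) Rq) = 1 + (10 : Rq) • X := by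
  have h1 : ∀ a b, ∃ y, (g : Matrix (Fin 5) (Fin 5) Rq) a b - (1 : Matrix (Fin 5) (Fin 5) Rq) a b
      = 10 * y := by
    intro a b
    apply redq_zero
    have h2 : ((redG g : GL (Fin 5) Q10) : Matrix (Fin 5) (Fin 5) Q10) a b = (1 : Matrix (Fin 5) (Fin 5) Q10) a b := by
      rw [h]; rfl
    have h3 : ((redG g : GL (Fin 5) Q10) : Matrix (Fin 5) (Fin 5) Q10) a b = redq ((g : Matrix (Fin 5) (Fin 5) Rq) a b) := rfl
    rw [map_sub, ← h3, h2, Matrix.one_apply, Matrix.one_apply]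
    split_ifs <;> simp
  choose X hX using h1
  refine ⟨Matrix.of X, ?_⟩
  ext1 a b
  rw [Matrix.add_apply, Matrix.smul_apply, Matrix.of_apply, smul_eq_mul, ← hX]
  ring

theorem inv_entry (g : GL5) (hg : g ∈ OGd) (i j : Fin 5) :
    (g : Matrix (Fin 5) (Fin 5) Rq) j i * gd j = gd i * ((g⁻¹ : GL5) : Matrix (Fin 5) (Fin 5) Rq) i j := by
  have h : (g : Matrix (Fin 5) (Fin 5) Rq)ᵀ * Gd * (g : Matrix (Fin 5) (Fin 5) Rq) = Gd := hg
  have h1 : (g : Matrix (Fin 5) (Fin 5) Rq) * ((g⁻¹ : GL5) : Matrix (Fin 5) (Fin 5) Rq) = 1 := g.mul_inv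
  have h2 : (g : Matrix (Fin 5) (Fin 5) Rq)ᵀ * Gd = Gd * ((g⁻¹ : GL5) : Matrix (Fin 5) (Fin 5) Rq) := by
    conv_rhs => rw [← h]
    rw [Matrix.mul_assoc, h1, Matrix.mul_one]
  have h3 := congrFun (congrFun h2 i) j
  rw [Gd, Matrix.mul_diagonal, Matrix.diagonal_mul, Matrix.transpose_apply] at h3
  exact h3

theorem col_norm (g : GL5) (hg : g ∈ OGd) :
    ⟨0, -1⟩ * (g : Matrix (Fin 5) (Fin 5) Rq) 0 1 ^ 2 + (g : Matrix (Fin 5) (Fin 5) Rq) 1 1 ^ 2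
     + (g : Matrix (Fin 5) (Fin 5) Rq) 2 1 ^ 2 + (g : Matrix (Fin 5) (Fin 5) Rq) 3 1 ^ 2
     + (g : Matrix (Fin 5) (Fin 5) Rq) 4 1 ^ 2 = 1 := by
  have h : (g : Matrix (Fin 5) (Fin 5) Rq)ᵀ * Gd * (g : Matrix (Fin 5) (Fin 5) Rq) = Gd := hg
  have h3 := congrFun (congrFun h 1) 1
  rw [Matrix.mul_apply, Fin.sum_univ_five] at h3
  simp only [Gd, Matrix.mul_diagonal, Matrix.transpose_apply, Matrix.diagonal_apply_eq] at h3
  simp only [gd, Matrix.cons_val] at h3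
  linear_combination h3

theorem tau_g0 : tau ⟨0, -1⟩ = - phi := by rw [tau_apply]; simp
theorem sig_g0 : sig ⟨0, -1⟩ = - phj := by rw [sig_apply]; simp

theorem entry_dich (w : W) (hw : redG (rho w) = 1) (hp : w ∉ pent) :
    3 ≤ |tau ((rho w⁻¹ : Matrix (Fin 5) (Fin 5) Rq) 1 1)| := by
  set M' := (rho w⁻¹ : Matrix (Fin 5) (Fin 5) Rq) with hM'
  set M := (rho w : Matrix (Fin 5) (Fin 5) Rq) with hM
  have hn := col_norm (rho w⁻¹) (rho_mem _)
  have h41 : M' 4 1 = 0 := by rw [hM', rho_row4]; decide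
  rw [← hM', h41] at hn
  have hs := congrArg sig hn
  simp only [map_add, map_mul, map_pow, map_one, map_zero, sig_g0] at hs
  have hj := phj_lt
  obtain ⟨X, hX⟩ := redG_ker (rho w⁻¹) (by rw [map_inv, map_inv, hw, inv_one])
  have hb : M' 1 1 = 1 + 10 * X 1 1 := by
    rw [hM', hX]; simp
  by_cases hβ : X 1 1 = 0
  · exfalso
    have hb1 : M' 1 1 = 1 := by rw [hb, hβ]; simp
    rw [hb1] at hs
    simp only [map_one] at hs
    have z0 : 0 ≤ -phj * sig (M' 0 1) ^ 2 := mul_nonneg (by linarith) (sq_nonneg _)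
    have z2 := sq_nonneg (sig (M' 2 1))
    have z3 := sq_nonneg (sig (M' 3 1))
    have c0 : M' 0 1 = 0 := by
      apply sig_inj
      rw [map_zero]
      have : -phj * sig (M' 0 1) ^ 2 = 0 := by linarith
      rcases mul_eq_zero.1 this with h | h
      · linarith
      · exact pow_eq_zero_iff (two_ne_zero) |>.1 h
    have c2 : M' 2 1 = 0 := by
      apply sig_inj
      rw [map_zero]
      have : sig (M' 2 1) ^ 2 = 0 := by linarith
      exact pow_eq_zero_iff (two_ne_zero) |>.1 this
    have c3 : M' 3 1 = 0 := by
      apply sig_inj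
      rw [map_zero]
      have : sig (M' 3 1) ^ 2 = 0 := by linarith
      exact pow_eq_zero_iff (two_ne_zero) |>.1 this
    have hMM : M * M' = 1 := by
      rw [hM, hM', ← Units.val_mul, ← map_mul, mul_inv_cancel, map_one]; rfl
    have hcol : ∀ a, M a 1 = (1 : Matrix (Fin 5) (Fin 5) Rq) a 1 := by
      intro a
      rw [← hMM, Matrix.mul_apply, Fin.sum_univ_five, c0, c2, c3, h41, hb1]
      ring
    have hrow : ∀ a, M 1 a = gd a * M' a 1 := by
      intro a
      have := inv_entry (rho w) (rho_mem w) a 1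
      rw [← map_inv] at this
      rw [← this]
      simp [gd, hM]
    have r0 : M 1 0 = 0 := by rw [hrow, c0, mul_zero]
    have r2 : M 1 2 = 0 := by rw [hrow, c2, mul_zero]
    have r3 : M 1 3 = 0 := by rw [hrow, c3, mul_zero]
    have r4 : M 1 4 = 0 := by rw [hrow, h41, mul_zero]
    have d0 : M 0 1 = 0 := by rw [hcol]; rfl
    have d2 : M 2 1 = 0 := by rw [hcol]; rfl
    have d3 : M 3 1 = 0 := by rw [hcol]; rfl
    have d4 : M 4 1 = 0 := by rw [hcol]; rfl
    have hcomm : M * Rm 0 = Rm 0 * M := by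
      rw [Rm_zero]
      ext1 a b
      rw [Matrix.mul_diagonal, Matrix.diagonal_mul]
      fin_cases a <;> fin_cases b <;> simp [r0, r2, r3, r4, d0, d2, d3, d4]
    have hw0 : w * rr 0 = rr 0 * w := by
      apply rho_inj
      rw [map_mul, map_mul, rho_rr]
      exact Units.ext hcomm
    rcases comm_mem 0 w hw0 with h | h
    · exact hp h
    · have h1 := pent_col1 _ h 1
      rw [map_mul, rho_rr, Units.val_mul] at h1
      change (M * Rm 0) 1 1 = 1 at h1
      rw [Rm_zero, Matrix.mul_diagonal, hcol] at h1
      revert h1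
      decide +kernel
  · have hσ : sig (M' 1 1) ^ 2 ≤ 1 := by
      have z0 : 0 ≤ -phj * sig (M' 0 1) ^ 2 := mul_nonneg (by linarith) (sq_nonneg _)
      have z2 := sq_nonneg (sig (M' 2 1))
      have z3 := sq_nonneg (sig (M' 3 1))
      linarith
    have hσ' := abs_le.1 ((sq_le_one_iff_abs_le_one _).1 hσ)
    have hnm := nm_ge _ hβ
    rw [hb] at hσ' ⊢
    simp only [map_add, map_mul, map_one, map_ofNat] at hσ' ⊢
    have hsb : |sig (X 1 1)| ≤ 1 / 5 := by
      rw [abs_le]; constructor <;> linarith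
    have htb : 5 ≤ |tau (X 1 1)| := by nlinarith [abs_nonneg (tau (X 1 1))]
    have := abs_sub_abs_le_abs_sub (10 * tau (X 1 1)) (-1)
    rw [abs_mul, abs_neg, abs_one, abs_of_pos (by norm_num : (0:ℝ) < 10)] at this
    rw [show (1 : ℝ) + 10 * tau (X 1 1) = 10 * tau (X 1 1) - -1 by ring]
    linarith
end

section
theorem sub_fg_map {A B : Type*} [Group A] [Group B] (f : A →* B) (K : Subgroup A) (h : K.FG) :
    (K.map f).FG := by
  obtain ⟨F, hF, hfin⟩ := (Subgroup.fg_iff _).1 h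
  refine (Subgroup.fg_iff _).2 ⟨f '' F, ?_, hfin.image f⟩
  rw [← hF, MonoidHom.map_closure]

noncomputable def psi : W →* GL (Fin 5) Q10 := redG.comp rho
noncomputable def Np : Subgroup W := Nst ⊓ psi.ker

theorem Np_fg : Group.FG Np := by
  have : Group.FG Nst := (Group.fg_iff_subgroup_fg _).2 Nst_fg
  have h1 : (psi.comp Nst.subtype).ker.FiniteIndex := Subgroup.finiteIndex_ker _
  have h2 : (psi.comp Nst.subtype).ker.FG :=
    (Group.fg_iff_subgroup_fg _).1 (Subgroup.fg_of_index_ne_zero _)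
  have h3 : Np = (psi.comp Nst.subtype).ker.map Nst.subtype := by
    ext w
    simp only [Np, Subgroup.mem_inf, Subgroup.mem_map, MonoidHom.mem_ker, MonoidHom.comp_apply]
    constructor
    · rintro ⟨h, h'⟩
      exact ⟨⟨w, h⟩, h', rfl⟩
    · rintro ⟨x, hx, rfl⟩
      exact ⟨x.2, hx⟩
  rw [Group.fg_iff_subgroup_fg, h3]
  exact sub_fg_map _ _ h2

noncomputable def Cp : Subgroup Np := pent.subgroupOf Np

theorem Cp_not_fg : ¬ Cp.FG := by
  intro h
  have h2 := sub_fg_map Np.subtype _ h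
  revert h2
  have hcard : Nat.card (GL (Fin 5) Q10) ≠ 0 := Nat.card_pos.ne'
  refine not_fg_of _ ?_ ?_ (Nat.card (GL (Fin 5) Q10)) hcard ?_
  · rintro _ ⟨x, _, rfl⟩
    exact x.2.1
  · rintro _ ⟨x, hx, rfl⟩
    exact hx
  · intro k
    have hk : pp ^ k * c0 ^ (Nat.card (GL (Fin 5) Q10)) * (pp ^ k)⁻¹ ∈ psi.ker := by
      rw [MonoidHom.mem_ker, map_mul, map_mul, map_inv, map_pow psi c0, pow_card_eq_one']
      simp
    exact ⟨⟨_, conj_mem_Nst _ k, hk⟩, conj_mem_pent _ k, rfl⟩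

noncomputable def G0 : Subgroup GL5 := OGd ⊓ redG.ker

noncomputable def fT : Np →* G0 :=
  (rho.comp Np.subtype).codRestrict G0 fun n => ⟨rho_mem _, n.2.2⟩

noncomputable def fF : Np →* G0 :=
  ((MulAut.conj su).toMonoidHom.comp (rho.comp Np.subtype)).codRestrict G0 fun n => by
    refine ⟨OGd.mul_mem (OGd.mul_mem su_mem (rho_mem _)) (OGd.inv_mem su_mem), ?_⟩
    exact (MonoidHom.normal_ker redG).conj_mem _ n.2.2 su

@[reducible] noncomputable def actG0 : MulAction G0 (Fin 5 → ℝ) where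
  smul g x := ((g.1 : Matrix (Fin 5) (Fin 5) Rq).map tau) *ᵥ x
  one_smul x := by
    change ((1 : Matrix (Fin 5) (Fin 5) Rq).map tau) *ᵥ x = x
    rw [Matrix.map_one _ (map_zero _) (map_one _), one_mulVec]
  mul_smul g h x := by
    change (((g.1 : Matrix (Fin 5) (Fin 5) Rq) * (h.1 : Matrix (Fin 5) (Fin 5) Rq)).map tau) *ᵥ x = 
      ((g.1 : Matrix (Fin 5) (Fin 5) Rq).map tau) *ᵥ (((h.1 : Matrix (Fin 5) (Fin 5) Rq).map tau) *ᵥ x)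
    rw [Matrix.map_mul, mulVec_mulVec]

noncomputable def Fq (x : Fin 5 → ℝ) : ℝ :=
  - phi * x 0 ^ 2 + x 1 ^ 2 + x 2 ^ 2 + x 3 ^ 2 + x 4 ^ 2

theorem Fq_eq (x : Fin 5 → ℝ) : Fq x = x ⬝ᵥ ((Gd.map tau) *ᵥ x) := by
  have h : Gd.map tau = Matrix.diagonal ![-phi, 1, 1, 1, 1] := by
    rw [Gd, Matrix.diagonal_map (map_zero _)]
    congr 1
    ext i
    fin_cases i <;> simp [gd, tau_g0]
  rw [h, dotProduct, Fin.sum_univ_five]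
  simp only [Matrix.mulVec_diagonal, Fq]
  simp
  ring

theorem Fq_inv (g : GL5) (hg : g ∈ OGd) (x : Fin 5 → ℝ) :
    Fq (((g : Matrix (Fin 5) (Fin 5) Rq).map tau) *ᵥ x) = Fq x := by
  have h : (g : Matrix (Fin 5) (Fin 5) Rq)ᵀ * Gd * (g : Matrix (Fin 5) (Fin 5) Rq) = Gd := hg
  have h2 := congrArg (fun A : Matrix (Fin 5) (Fin 5) Rq => A.map tau) h
  simp only [Matrix.map_mul] at h2
  rw [Matrix.transpose_map] at h2
  rw [Fq_eq, Fq_eq]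
  conv_rhs => rw [← h2]
  rw [← mulVec_mulVec, ← mulVec_mulVec, dotProduct_mulVec x, vecMul_transpose]

noncomputable def Sset : Bool → Set (Fin 5 → ℝ)
  | true => {x | Fq x < 0 ∧ |x 4| < |x 1|}
  | false => {x | Fq x < 0 ∧ |x 1| < |x 4|}

def sv (x : Fin 5 → ℝ) : Fin 5 → ℝ := ![x 0, x 4, x 2, x 3, x 1]

theorem su_mulVec (x : Fin 5 → ℝ) : ((su : Matrix (Fin 5) (Fin 5) Rq).map tau) *ᵥ x = sv x := by
  ext i
  rw [Matrix.mulVec, dotProduct, Fin.sum_univ_five]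
  fin_cases i <;> simp [su, ssw, sv]

theorem Fq_sv (x : Fin 5 → ℝ) : Fq (sv x) = Fq x := by
  rw [← su_mulVec, Fq_inv _ su_mem]

theorem sv_sv (x : Fin 5 → ℝ) : sv (sv x) = x := by
  ext i; fin_cases i <;> simp [sv]

theorem sv_mem (a : Bool) (x : Fin 5 → ℝ) : sv x ∈ Sset a ↔ x ∈ Sset (!a) := by
  cases a <;> simp only [Sset, Bool.not_true, Bool.not_false, Set.mem_ofPred_eq, Fq_sv] <;>
    simp [sv]

theorem row4_real (w : W) (x : Fin 5 → ℝ) :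
    (((rho w : Matrix (Fin 5) (Fin 5) Rq).map tau) *ᵥ x) 4 = x 4 := by
  rw [Matrix.mulVec, dotProduct, Fin.sum_univ_five]
  simp [rho_row4]

theorem pingpong (w : W) (hw : redG (rho w) = 1) (hp : w ∉ pent) (x : Fin 5 → ℝ)
    (hx : x ∈ Sset false) : ((rho w : Matrix (Fin 5) (Fin 5) Rq).map tau) *ᵥ x ∈ Sset true := by
  obtain ⟨h1, h2⟩ := hx
  refine ⟨by rw [Fq_inv _ (rho_mem w)]; exact h1, ?_⟩
  rw [row4_real]
  have hn := col_norm (rho w⁻¹) (rho_mem _)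
  have h41 : (rho w⁻¹ : Matrix (Fin 5) (Fin 5) Rq) 4 1 = 0 := by rw [rho_row4]; decide
  rw [h41] at hn
  have hs := congrArg tau hn
  simp only [map_add, map_mul, map_pow, map_one, map_zero, tau_g0] at hs
  have hrow : ∀ a, (rho w : Matrix (Fin 5) (Fin 5) Rq) 1 a =
      gd a * (rho w⁻¹ : Matrix (Fin 5) (Fin 5) Rq) a 1 := by
    intro a
    have := inv_entry (rho w) (rho_mem w) a 1
    rw [← map_inv] at this
    rw [← this]
    simp [gd]
  have hval : (((rho w : Matrix (Fin 5) (Fin 5) Rq).map tau) *ᵥ x) 1 =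
      -phi * tau ((rho w⁻¹ : Matrix (Fin 5) (Fin 5) Rq) 0 1) * x 0 +
      tau ((rho w⁻¹ : Matrix (Fin 5) (Fin 5) Rq) 1 1) * x 1 +
      tau ((rho w⁻¹ : Matrix (Fin 5) (Fin 5) Rq) 2 1) * x 2 +
      tau ((rho w⁻¹ : Matrix (Fin 5) (Fin 5) Rq) 3 1) * x 3 := by
    rw [Matrix.mulVec, dotProduct, Fin.sum_univ_five]
    simp only [Matrix.map_apply, hrow, h41, map_mul]
    simp [gd, tau_g0]
  rw [hval]
  exact pp_real phi _ _ _ _ _ _ _ _ _ (by linarith [phi_gt]) (by linarith) (entry_dich w hw hp) h1 h2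

noncomputable def ff : Bool → Np →* G0
  | true => fT
  | false => fF

def xb : Bool → Fin 5 → ℝ
  | true => ![1, 1, 0, 0, 0]
  | false => ![1, 0, 0, 0, 1]

theorem fT_smul (n : Np) (x : Fin 5 → ℝ) : actG0.toSMul.smul (fT n) x =
    ((rho n : Matrix (Fin 5) (Fin 5) Rq).map tau) *ᵥ x := rfl

theorem fF_smul (n : Np) (x : Fin 5 → ℝ) : actG0.toSMul.smul (fF n) x =
    sv (((rho n : Matrix (Fin 5) (Fin 5) Rq).map tau) *ᵥ sv x) := by
  have h : ((fF n).1 : Matrix (Fin 5) (Fin 5) Rq) = (su : Matrix (Fin 5) (Fin 5) Rq) * (rho n : Matrix (Fin 5) (Fin 5) Rq) * (su : Matrix (Fin 5) (Fin 5) Rq) := rfl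
  change ((fF n).1 : Matrix (Fin 5) (Fin 5) Rq).map tau *ᵥ x = _
  rw [h, Matrix.map_mul, Matrix.map_mul, ← mulVec_mulVec, ← mulVec_mulVec, su_mulVec, su_mulVec]

theorem G0_noncoherent : ∃ H : Subgroup G0, Group.FG H ∧ ¬ IsFinitelyPresented H := by
  let := actG0
  have := Np_fg
  refine amalgam_not_fp (Ω := Fin 5 → ℝ) Cp Cp_not_fg ff ?_ Sset xb ?_ ?_ ?_ ?_ ?_
  · intro c hc
    apply Subtype.ext
    change rho c = su * rho c * su⁻¹
    rw [pent_comm (c : W) hc, mul_inv_cancel_right]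
  · intro a
    have := phi_gt
    cases a
    · refine ⟨?_, ?_⟩
      · simp [Fq, xb]; linarith
      · simp [xb]
    · refine ⟨?_, ?_⟩
      · simp [Fq, xb]; linarith
      · simp [xb]
  · intro a y hy hy'
    cases a
    · exact lt_asymm hy.2 hy'.2
    · exact lt_asymm hy.2 hy'.2
  · intro a n hn y hy
    cases a
    · change actG0.toSMul.smul (fF n) y ∈ _
      rw [fF_smul, sv_mem]
      exact pingpong _ n.2.2 hn _ ((sv_mem _ _).2 hy)
    · exact pingpong _ n.2.2 hn y hy
  · intro a n
    cases a
    · change actG0.toSMul.smul (fF n) _ ∉ _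
      rw [fF_smul, sv_mem]
      rintro ⟨_, h⟩
      rw [row4_real] at h
      simp [sv, xb] at h
      exact absurd h (not_lt.2 (abs_nonneg _))
    · rintro ⟨_, h⟩
      have : (((rho n : Matrix (Fin 5) (Fin 5) Rq).map tau) *ᵥ xb true) 4 = 0 := by
        rw [row4_real]; rfl
      change _ < |(((rho n : Matrix (Fin 5) (Fin 5) Rq).map tau) *ᵥ xb true) 4| at h
      rw [this, abs_zero] at h
      exact absurd h (not_lt.2 (abs_nonneg _))
  · intro a b h
    exact Subtype.ext (rho_inj (congrArg Subtype.val h))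
end

section
def Sm : Matrix (Fin 5) (Fin 5) Rq :=
  !![0, 0, 0, 0, ⟨4, 2⟩;
     -2, 0, ⟨1, 1⟩, 0, ⟨-1, -2⟩;
     ⟨0, -2⟩, ⟨2, 1⟩, ⟨0, -1⟩, 0, ⟨1, 1⟩;
     0, ⟨-1, 1⟩, ⟨1, -2⟩, ⟨0, 2⟩, ⟨-2, -3⟩;
     0, 1, 0, -2, ⟨-2, -2⟩]

def Sp : Matrix (Fin 5) (Fin 5) Rq :=
  !![⟨7, 11⟩, ⟨-2, 4⟩, ⟨-1, -3⟩, ⟨3, 4⟩, ⟨4, 7⟩;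
     ⟨8, 14⟩, ⟨4, 2⟩, ⟨2, -4⟩, ⟨2, 6⟩, ⟨6, 8⟩;
     ⟨5, 10⟩, ⟨4, 2⟩, ⟨2, -4⟩, ⟨4, 2⟩, ⟨2, 6⟩;
     ⟨2, 6⟩, ⟨2, 1⟩, ⟨1, -2⟩, ⟨1, 3⟩, ⟨-2, 4⟩;
     ⟨3, -1⟩, 0, 0, 0, 0]

def Q2m : Matrix (Fin 5) (Fin 5) Rq :=
  !![2, ⟨0, -1⟩, 0, 0, 0;
     ⟨0, -1⟩, 2, -1, 0, 0;
     0, -1, 2, -1, 0;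
     0, 0, -1, 2, ⟨0, -1⟩;
     0, 0, 0, ⟨0, -1⟩, 2]

theorem Sp_Sm : Sp * Sm = (10 : Rq) • 1 := by decide +kernel
theorem Sm_Sp : Sm * Sp = (10 : Rq) • 1 := by decide +kernel
theorem Sm_orth : (2 : Rq) • (Smᵀ * Gd * Sm) = (⟨8, 4⟩ : Rq) • Q2m := by decide +kernel

theorem Rq_cancel (c : Rq) (hc : c ≠ 0) {A B : Matrix (Fin 5) (Fin 5) Rq} (h : c • A = c • B) :
    A = B := by
  ext1 i j
  have h1 := congrFun (congrFun h i) j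
  rw [Matrix.smul_apply, Matrix.smul_apply, smul_eq_mul, smul_eq_mul] at h1
  have h2 := congrArg tau h1
  rw [map_mul, map_mul] at h2
  refine tau_inj (mul_left_cancel₀ ?_ h2)
  intro h3
  exact hc (tau_inj (by rw [h3, map_zero]))

theorem ten_ne : (10 : Rq) ≠ 0 := by decide +kernel

theorem Sm_cancel {A B : Matrix (Fin 5) (Fin 5) Rq} (h : Sm * A = Sm * B) : A = B := by
  apply Rq_cancel 10 ten_ne
  have := congrArg (fun X => Sp * X) h
  simpa [← Matrix.mul_assoc, Sp_Sm] using this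

theorem Sm_cancel_right {A B : Matrix (Fin 5) (Fin 5) Rq} (h : A * Sm = B * Sm) : A = B := by
  apply Rq_cancel 10 ten_ne
  have := congrArg (fun X => X * Sp) h
  simpa [Matrix.mul_assoc, Sm_Sp] using this

theorem exists_T (g : G0) : ∃ T : Matrix (Fin 5) (Fin 5) Rq,
    Sm * T = (g.1 : Matrix (Fin 5) (Fin 5) Rq) * Sm := by
  obtain ⟨X, hX⟩ := redG_ker g.1 g.2.2
  refine ⟨1 + Sp * X * Sm, ?_⟩
  rw [hX, Matrix.mul_add, Matrix.add_mul, ← Matrix.mul_assoc, ← Matrix.mul_assoc, Sm_Sp]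
  simp

noncomputable def Tm (g : G0) : Matrix (Fin 5) (Fin 5) Rq := (exists_T g).choose
theorem Tm_spec (g : G0) : Sm * Tm g = (g.1 : Matrix (Fin 5) (Fin 5) Rq) * Sm :=
  (exists_T g).choose_spec

noncomputable def TmH : G0 →* Matrix (Fin 5) (Fin 5) Rq where
  toFun := Tm
  map_one' := Sm_cancel (by rw [Tm_spec]; simp)
  map_mul' g h := Sm_cancel (by
    rw [Tm_spec, ← Matrix.mul_assoc, Tm_spec, Matrix.mul_assoc, Tm_spec, ← Matrix.mul_assoc]; rfl)

noncomputable def TmU : G0 →* GL5 := TmH.toHomUnits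

theorem TmU_val (g : G0) : (TmU g : Matrix (Fin 5) (Fin 5) Rq) = Tm g := rfl

theorem TmU_inj : Function.Injective TmU := by
  intro g h hgh
  have h1 : Tm g = Tm h := by rw [← TmU_val, hgh, TmU_val]
  apply Subtype.ext
  apply Units.ext
  apply Sm_cancel_right
  rw [← Tm_spec, ← Tm_spec, h1]

theorem Tm_orth (g : G0) : (Tm g)ᵀ * Q2m * Tm g = Q2m := by
  have hg : (g.1 : Matrix (Fin 5) (Fin 5) Rq)ᵀ * Gd * (g.1 : Matrix (Fin 5) (Fin 5) Rq) = Gd := g.2.1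
  apply Rq_cancel ⟨8, 4⟩ (by decide +kernel)
  have h1 : (⟨8, 4⟩ : Rq) • ((Tm g)ᵀ * Q2m * Tm g) = (Tm g)ᵀ * ((⟨8, 4⟩ : Rq) • Q2m) * Tm g := by simp
  rw [h1, ← Sm_orth]
  have h2 : (Tm g)ᵀ * ((2 : Rq) • (Smᵀ * Gd * Sm)) * Tm g =
      (2 : Rq) • ((Sm * Tm g)ᵀ * Gd * (Sm * Tm g)) := by
    rw [Matrix.transpose_mul]; simp [Matrix.mul_assoc]
  rw [h2, Tm_spec]
  congr 1
  rw [Matrix.transpose_mul]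
  conv_rhs => rw [← hg]
  simp only [Matrix.mul_assoc]

noncomputable def phK : Ksqrt5 := (1 + sqrt5) / 2

theorem sqrt5_sq : sqrt5 * sqrt5 = 5 := by
  apply Subtype.ext
  change Real.sqrt 5 * Real.sqrt 5 = 5
  exact s5

theorem phK_sq : phK * phK = 1 + phK := by
  unfold phK; linear_combination sqrt5_sq / 4

theorem phK_int : IsIntegral ℤ phK := by
  refine ⟨Polynomial.X ^ 2 - Polynomial.X - 1, ?_, ?_⟩
  · monicity!
  · simp only [Polynomial.eval₂_sub, Polynomial.eval₂_pow, Polynomial.eval₂_X, Polynomial.eval₂_one]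
    linear_combination phK_sq

noncomputable def phA : Asqrt5 := ⟨phK, phK_int⟩

theorem phA_sq : phA * phA = 1 + phA := NumberField.RingOfIntegers.ext phK_sq

noncomputable def jA : Rq →+* Asqrt5 := evq phA phA_sq
noncomputable def jK : Rq →+* Ksqrt5 := evq phK phK_sq

theorem jA_jK (z : Rq) : algebraMap Asqrt5 Ksqrt5 (jA z) = jK z := by
  rw [jA, jK, evq_apply, evq_apply]
  simp only [map_add, map_mul, map_intCast]
  rfl

theorem jK_inj : Function.Injective jK := by
  intro x y h
  apply tau_inj
  have h1 : ∀ z : Rq, ((jK z : Ksqrt5) : ℝ) = tau z := by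
    intro z
    rw [jK, evq_apply, tau_apply]
    push_cast
    rfl
  rw [← h1, ← h1, h]

theorem jA_inj : Function.Injective jA := by
  intro x y h
  apply jK_inj
  rw [← jA_jK, ← jA_jK, h]

theorem Q2m_map : Q2m.map jK = (2 : Ksqrt5) • Q120 := by
  have h1 : jK ⟨0, -1⟩ = 2 * (-(1 + sqrt5) / 4) := by
    rw [jK, evq_apply, phK]; push_cast; ring
  have h2 : jK 2 = 2 := map_ofNat jK 2
  ext1 i j
  rw [Matrix.smul_apply, Matrix.map_apply]
  fin_cases i <;> fin_cases j <;> simp [Q2m, Q120, h1, h2]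

noncomputable def thG : G0 →* orthoGram Asqrt5 Q120 :=
  ((Matrix.GeneralLinearGroup.map jA).comp TmU).codRestrict _ fun g => by
    have hM : (((Matrix.GeneralLinearGroup.map jA).comp TmU g : GL (Fin 5) Asqrt5) :
        Matrix (Fin 5) (Fin 5) Asqrt5).map (algebraMap Asqrt5 Ksqrt5) = (Tm g).map jK := by
      ext1 i j
      exact jA_jK _
    change ((((Matrix.GeneralLinearGroup.map jA).comp TmU g : GL (Fin 5) Asqrt5) :
        Matrix (Fin 5) (Fin 5) Asqrt5).map (algebraMap Asqrt5 Ksqrt5))ᵀ * Q120 *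
        (((Matrix.GeneralLinearGroup.map jA).comp TmU g : GL (Fin 5) Asqrt5) :
        Matrix (Fin 5) (Fin 5) Asqrt5).map (algebraMap Asqrt5 Ksqrt5) = Q120
    rw [hM]
    have h := congrArg (fun X : Matrix (Fin 5) (Fin 5) Rq => X.map jK) (Tm_orth g)
    simp only [Matrix.map_mul, Q2m_map] at h
    rw [Matrix.transpose_map, Matrix.mul_smul, Matrix.smul_mul] at h
    exact smul_right_injective _ (two_ne_zero : (2 : Ksqrt5) ≠ 0) h

theorem thG_inj : Function.Injective thG := by
  intro g h hgh
  apply TmU_inj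
  have h1 := congrArg Subtype.val hgh
  apply Units.ext
  ext1 i j
  apply jA_inj
  exact congrArg (fun u : GL (Fin 5) Asqrt5 => (u : Matrix (Fin 5) (Fin 5) Asqrt5) i j) h1
end

/-- Bowditch–Mess. The group `O(q, A)` of the quadratic form of the
right-angled regular 120-cell over the ring of integers `A` of `ℚ(√5)` is noncoherent. -/
theorem O_Q120_noncoherent :
    ∃ H : Subgroup ↥(orthoGram Asqrt5 Q120), Group.FG ↥H ∧ ¬ IsFinitelyPresented ↥H := by
  obtain ⟨H, h1, h2⟩ := G0_noncoherent
  let e := H.equivMapOfInjective thG thG_inj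
  refine ⟨H.map thG, ?_, ?_⟩
  · rw [Group.fg_iff_subgroup_fg] at h1 ⊢
    exact sub_fg_map _ _ h1
  · rintro ⟨n, rels, hfin, ⟨e'⟩⟩
    exact h2 ⟨n, rels, hfin, ⟨e'.trans e.symm⟩⟩

end Paper
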